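/- arXiv:2408.13110 — 3 statements merged into one kernel-verified Lean document; each statement's English description precedes it below -/
import Mathlib

section
/- Let Ω ⊂ ℝ³ be open, bounded, connected and simply connected (the paper assumes a bounded, simply connected Lipschitz set). Assume the ellipticity conditions η₂ < η₁ < η₃ and η₂ + η₃ > 2η₁, and let u: ℝ³ → ℝ³ be Lipschitz with e(u)(x) ∈ K₃ for a.e. x ∈ Ω. Then the diagonal components of the strain are constant: there exist c₁, c₂, c₃ ∈ ℝ such that e(u)_{jj}(x) = c_j for a.e. x ∈ Ω and each j ∈ {1,2,3}. -/
open Matrix MeasureTheory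

noncomputable section

/-- Three-dimensional Euclidean space. -/
abbrev V3 : Type := EuclideanSpace ℝ (Fin 3)

/-- The three wells `e⁽¹⁾ = diag(η₃, η₁, η₂)`, `e⁽²⁾ = diag(η₂, η₃, η₁)`,
`e⁽³⁾ = diag(η₁, η₂, η₃)` (0-indexed). -/
def well3 (η₁ η₂ η₃ : ℝ) : Fin 3 → Matrix (Fin 3) (Fin 3) ℝ :=
  ![Matrix.diagonal ![η₃, η₁, η₂], Matrix.diagonal ![η₂, η₃, η₁], Matrix.diagonal ![η₁, η₂, η₃]]

/-- The set `K₃ = {e⁽¹⁾, e⁽²⁾, e⁽³⁾}`. -/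
def K3 (η₁ η₂ η₃ : ℝ) : Set (Matrix (Fin 3) (Fin 3) ℝ) :=
  {well3 η₁ η₂ η₃ 0, well3 η₁ η₂ η₃ 1, well3 η₁ η₂ η₃ 2}

/-- The symmetrized gradient `e(u)(x) = (1/2)(∇u(x) + ∇u(x)ᵀ)`, expressed via `fderiv`
(which, by Rademacher's theorem, exists a.e. for Lipschitz `u`). -/
def symGrad3 (u : V3 → V3) (x : V3) : Matrix (Fin 3) (Fin 3) ℝ := fun i j =>
  (fderiv ℝ u x (EuclideanSpace.single j 1) i + fderiv ℝ u x (EuclideanSpace.single i 1) j) / 2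

instance isAddHaarMeasure_volume_prod {E F : Type*}
    [NormedAddCommGroup E] [MeasureSpace E] [BorelSpace E] [SecondCountableTopology E]
    [LocallyCompactSpace E] [(volume : Measure E).IsAddHaarMeasure]
    [NormedAddCommGroup F] [MeasureSpace F] [BorelSpace F] [SecondCountableTopology F]
    [LocallyCompactSpace F] [(volume : Measure F).IsAddHaarMeasure] :
    (volume : Measure (E × F)).IsAddHaarMeasure :=
  Measure.prod.instIsAddHaarMeasure volume volume

/-- A property holding almost everywhere pulls back along a surjective linear map. -/
lemma ae_comp_of_isLinearMap {E F : Type*}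
    [NormedAddCommGroup E] [NormedSpace ℝ E] [MeasureSpace E] [BorelSpace E]
    [LocallyCompactSpace E] [(volume : Measure E).IsAddHaarMeasure]
    [NormedAddCommGroup F] [NormedSpace ℝ F] [MeasureSpace F] [BorelSpace F]
    [(volume : Measure F).IsAddHaarMeasure]
    {p : F → Prop} (hp : ∀ᵐ y, p y) (L : E → F) (hL : IsLinearMap ℝ L)
    (hs : Function.Surjective L) : ∀ᵐ x, p (L x) := by
  obtain ⟨s, hps, hsm, hs0⟩ := exists_measurable_superset_of_null (ae_iff.1 hp)
  have := (ae_comp_linearMap_mem_iff (L := IsLinearMap.mk' L hL) (μ := volume) (ν := volume)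
    hs hsm.compl).2 (measure_eq_zero_iff_ae_notMem.1 hs0)
  filter_upwards [this] with x hx
  by_contra h
  exact hx (hps h)

lemma LipschitzWith.intervalIntegral_deriv {f : ℝ → ℝ} {K : NNReal} (hf : LipschitzWith K f)
    (a b : ℝ) : ∫ x in a..b, deriv f x = f b - f a :=
  ((hf.lipschitzOnWith (s := Set.uIcc a b)).absolutelyContinuousOnInterval).integral_deriv_eq_sub

/-- If `∂ₜf + ∂ₛg = 0` almost everywhere on a rectangle, then the fluxes through its sides
cancel. -/
lemma integral_sub_add_integral_sub_eq_zero {f g : ℝ → ℝ → ℝ} {K : NNReal}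
    (hf : ∀ s, LipschitzWith K (f s)) (hg : ∀ t, LipschitzWith K (fun s => g s t))
    (hgc : Continuous g.uncurry) {a b c d : ℝ}
    (h : ∀ᵐ p : ℝ × ℝ, p.1 ∈ Set.uIoc a b → p.2 ∈ Set.uIoc c d →
      deriv (f p.1) p.2 + deriv (fun s => g s p.2) p.1 = 0) :
    (∫ s in a..b, (f s d - f s c)) + ∫ t in c..d, (g b t - g a t) = 0 := by
  have hint : IntegrableOn (fun p : ℝ × ℝ => deriv (fun s => g s p.2) p.1)
      (Set.uIoc a b ×ˢ Set.uIoc c d) := by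
    have hm : Measurable (fun p : ℝ × ℝ => deriv (fun s => g s p.2) p.1) := by
      have hc : Continuous (Function.uncurry fun t s => g s t) :=
        hgc.comp continuous_swap
      exact (measurable_deriv_with_param hc).comp measurable_swap
    refine Measure.integrableOn_of_bounded (M := K) ?_ hm.aestronglyMeasurable ?_
    · rw [Measure.volume_eq_prod, Measure.prod_prod]
      exact ENNReal.mul_ne_top (by simp [Set.uIoc]) (by simp [Set.uIoc])
    · exact .of_forall fun p => norm_deriv_le_of_lipschitz (hg p.2)
  have hswap := intervalIntegral_intervalIntegral_swap
    (F := fun s t => deriv (fun s => g s t) s) hint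
  have h₁ : ∫ s in a..b, (f s d - f s c)
      = ∫ s in a..b, ∫ t in c..d, -deriv (fun s => g s t) s := by
    refine intervalIntegral.integral_congr_ae ?_
    filter_upwards [Measure.ae_ae_of_ae_prod h] with s hs hsI
    rw [← (hf s).intervalIntegral_deriv]
    refine intervalIntegral.integral_congr_ae ?_
    filter_upwards [hs] with t ht htI
    linarith [ht hsI htI]
  have h₂ : ∫ t in c..d, (g b t - g a t) = ∫ t in c..d, ∫ s in a..b, deriv (fun s => g s t) s := by
    simp_rw [fun t => (hg t).intervalIntegral_deriv a b]
  rw [h₁, h₂, ← hswap]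
  simp

/-- The version of `integral_sub_add_integral_sub_eq_zero` with an additional variable, in which a
further difference is taken. -/
lemma integral_mixed_add_integral_mixed_eq_zero {f g : ℝ → ℝ → ℝ → ℝ} {K : NNReal}
    (hf : ∀ s r, LipschitzWith K (fun t => f s t r))
    (hg : ∀ t r, LipschitzWith K (fun s => g s t r))
    (hfc : Continuous fun p : ℝ × ℝ × ℝ => f p.1 p.2.1 p.2.2)
    (hgc : Continuous fun p : ℝ × ℝ × ℝ => g p.1 p.2.1 p.2.2)
    {I J L : Set ℝ} (hI : I.OrdConnected) (hJ : J.OrdConnected) (hL : IsOpen L)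
    (h : ∀ᵐ p : ℝ × ℝ × ℝ, p.1 ∈ I → p.2.1 ∈ J → p.2.2 ∈ L →
      deriv (fun t => f p.1 t p.2.2) p.2.1 + deriv (fun s => g s p.2.1 p.2.2) p.1 = 0)
    {a b c d r r' : ℝ} (ha : a ∈ I) (hb : b ∈ I) (hc : c ∈ J) (hd : d ∈ J) (hr : r ∈ L)
    (hr' : r' ∈ L) :
    (∫ s in a..b, (f s d r' - f s c r' - (f s d r - f s c r)))
      + ∫ t in c..d, (g b t r' - g a t r' - (g b t r - g a t r)) = 0 := by
  have hfc' : Continuous ↿f := hfc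
  have hgc' : Continuous ↿g := hgc
  have key : ∀ r ∈ L, (∫ s in a..b, (f s d r - f s c r)) + ∫ t in c..d, (g b t r - g a t r) = 0 := by
    have hae := Measure.ae_ae_of_ae_prod
      (ae_comp_of_isLinearMap h (fun q : ℝ × ℝ × ℝ => (q.2.1, q.2.2, q.1))
        ⟨fun _ _ => rfl, fun _ _ => rfl⟩ fun q => ⟨(q.2.2, q.1, q.2.1), rfl⟩)
    have := Measure.eqOn_open_of_ae_eq (μ := volume) (U := L)
      (f := fun r => (∫ s in a..b, (f s d r - f s c r)) + ∫ t in c..d, (g b t r - g a t r))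
      (g := fun _ => 0) ?_ hL (by fun_prop) continuousOn_const
    · exact this
    refine (ae_restrict_iff' hL.measurableSet).2 ?_
    filter_upwards [hae] with r hr hrL
    refine integral_sub_add_integral_sub_eq_zero (K := K) (f := fun s t => f s t r)
      (g := fun s t => g s t r) (fun s => hf s r) (fun t => hg t r) ?_ ?_
    · change Continuous fun p : ℝ × ℝ => g p.1 p.2 r
      fun_prop
    · filter_upwards [hr] with p hp h1 h2
      exact hp (hI.uIcc_subset ha hb (Set.uIoc_subset_uIcc h1))
        (hJ.uIcc_subset hc hd (Set.uIoc_subset_uIcc h2)) hrL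
  rw [intervalIntegral.integral_sub (f := fun s => f s d r' - f s c r'),
    intervalIntegral.integral_sub (f := fun t => g b t r' - g a t r')]
  · linarith [key r hr, key r' hr']
  all_goals exact Continuous.intervalIntegrable (by fun_prop) _ _

/-- A continuous function all of whose integrals over subintervals of an open interval vanish is
zero there. -/
lemma eq_zero_of_forall_intervalIntegral_eq_zero {f : ℝ → ℝ} (hf : Continuous f) {I : Set ℝ}
    (hI : IsOpen I) (h : ∀ a ∈ I, ∀ b ∈ I, ∫ s in a..b, f s = 0) {a : ℝ} (ha : a ∈ I) :
    f a = 0 := by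
  have h1 : HasDerivAt (fun b => ∫ s in a..b, f s) (f a) a :=
    (hf.integral_hasStrictDerivAt a a).hasDerivAt
  have h2 : HasDerivAt (fun b => ∫ s in a..b, f s) 0 a :=
    (hasDerivAt_const a (0 : ℝ)).congr_of_eventuallyEq
      (Filter.eventually_of_mem (hI.mem_nhds ha) fun b hb => h a ha b hb)
  exact h1.unique h2

/-- If the off-diagonal symmetrized partial derivatives of `(f, g, k)` vanish almost everywhere on
a box, then the mixed second differences of each component in the other two variables vanish. -/
lemma mixed_difference_eq_zero {f g k : ℝ → ℝ → ℝ → ℝ} {K : NNReal}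
    (hf₂ : ∀ a c, LipschitzWith K (fun b => f a b c))
    (hf₃ : ∀ a b, LipschitzWith K (fun c => f a b c))
    (hg₁ : ∀ b c, LipschitzWith K (fun a => g a b c))
    (hg₃ : ∀ a b, LipschitzWith K (fun c => g a b c))
    (hk₁ : ∀ b c, LipschitzWith K (fun a => k a b c))
    (hk₂ : ∀ a c, LipschitzWith K (fun b => k a b c))
    (hf : Continuous fun p : ℝ × ℝ × ℝ => f p.1 p.2.1 p.2.2)
    (hg : Continuous fun p : ℝ × ℝ × ℝ => g p.1 p.2.1 p.2.2)
    (hk : Continuous fun p : ℝ × ℝ × ℝ => k p.1 p.2.1 p.2.2)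
    {I J L : Set ℝ} (hI : I.OrdConnected) (hJ : J.OrdConnected) (hL : L.OrdConnected)
    (hIo : IsOpen I) (hJo : IsOpen J) (hLo : IsOpen L)
    (h : ∀ᵐ p : ℝ × ℝ × ℝ, p.1 ∈ I → p.2.1 ∈ J → p.2.2 ∈ L →
      deriv (fun b => f p.1 b p.2.2) p.2.1 + deriv (fun a => g a p.2.1 p.2.2) p.1 = 0 ∧
      deriv (fun c => f p.1 p.2.1 c) p.2.2 + deriv (fun a => k a p.2.1 p.2.2) p.1 = 0 ∧
      deriv (fun c => g p.1 p.2.1 c) p.2.2 + deriv (fun b => k p.1 b p.2.2) p.2.1 = 0) :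
    (∀ a ∈ I, ∀ b ∈ J, ∀ b' ∈ J, ∀ c ∈ L, ∀ c' ∈ L,
      f a b' c' - f a b c' - (f a b' c - f a b c) = 0) ∧
    (∀ b ∈ J, ∀ a ∈ I, ∀ a' ∈ I, ∀ c ∈ L, ∀ c' ∈ L,
      g a' b c' - g a b c' - (g a' b c - g a b c) = 0) ∧
    (∀ c ∈ L, ∀ a ∈ I, ∀ a' ∈ I, ∀ b ∈ J, ∀ b' ∈ J,
      k a' b' c - k a b' c - (k a' b c - k a b c) = 0) := by
  have hf' : Continuous ↿f := hf
  have hg' : Continuous ↿g := hg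
  have hk' : Continuous ↿k := hk
  have main : ∀ a ∈ I, ∀ a' ∈ I, ∀ b ∈ J, ∀ b' ∈ J, ∀ c ∈ L, ∀ c' ∈ L,
      (∫ s in a..a', (f s b' c' - f s b c' - (f s b' c - f s b c)) = 0) ∧
      (∫ t in b..b', (g a' t c' - g a t c' - (g a' t c - g a t c)) = 0) ∧
      (∫ r in c..c', (k a' b' r - k a b' r - (k a' b r - k a b r)) = 0) := by
    intro a ha a' ha' b hb b' hb' c hc c' hc'
    have e₁ := integral_mixed_add_integral_mixed_eq_zero hf₂ hg₁ hf hg hI hJ hLo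
      (by filter_upwards [h] with p hp h1 h2 h3 using (hp h1 h2 h3).1) ha ha' hb hb' hc hc'
    have e₂ := integral_mixed_add_integral_mixed_eq_zero (f := fun a c b => f a b c)
      (g := fun a c b => k a b c) hf₃ (fun c b => hk₁ b c)
      (by fun_prop) (by fun_prop) hI hL hJo
      (by
        filter_upwards [ae_comp_of_isLinearMap h (fun q : ℝ × ℝ × ℝ => (q.1, q.2.2, q.2.1))
          ⟨fun _ _ => rfl, fun _ _ => rfl⟩ fun q => ⟨(q.1, q.2.2, q.2.1), rfl⟩]
          with p hp h1 h2 h3 using (hp h1 h3 h2).2.1) ha ha' hc hc' hb hb'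
    have e₃ := integral_mixed_add_integral_mixed_eq_zero (f := fun b c a => g a b c)
      (g := fun b c a => k a b c) (fun b a => hg₃ a b) (fun c a => hk₂ a c)
      (by fun_prop) (by fun_prop) hJ hL hIo
      (by
        filter_upwards [ae_comp_of_isLinearMap h (fun q : ℝ × ℝ × ℝ => (q.2.2, q.1, q.2.1))
          ⟨fun _ _ => rfl, fun _ _ => rfl⟩ fun q => ⟨(q.2.1, q.2.2, q.1), rfl⟩]
          with p hp h1 h2 h3 using (hp h3 h1 h2).2.2) hb hb' hc hc' ha ha'
    have r₁ : ∫ s in a..a', (f s b' c' - f s b' c - (f s b c' - f s b c))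
        = ∫ s in a..a', (f s b' c' - f s b c' - (f s b' c - f s b c)) := by
      congr 1; ext s; ring
    have r₂ : ∫ t in b..b', (g a' t c' - g a' t c - (g a t c' - g a t c))
        = ∫ t in b..b', (g a' t c' - g a t c' - (g a' t c - g a t c)) := by
      congr 1; ext t; ring
    have r₃ : ∫ r in c..c', (k a' b' r - k a' b r - (k a b' r - k a b r))
        = ∫ r in c..c', (k a' b' r - k a b' r - (k a' b r - k a b r)) := by
      congr 1; ext r; ring
    refine ⟨?_, ?_, ?_⟩ <;> linarith
  refine ⟨fun a ha b hb b' hb' c hc c' hc' => ?_, fun b hb a ha a' ha' c hc c' hc' => ?_,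
    fun c hc a ha a' ha' b hb b' hb' => ?_⟩
  · exact eq_zero_of_forall_intervalIntegral_eq_zero
      (f := fun s => f s b' c' - f s b c' - (f s b' c - f s b c)) (by fun_prop) hIo
      (fun a ha a' ha' => (main a ha a' ha' b hb b' hb' c hc c' hc').1) ha
  · exact eq_zero_of_forall_intervalIntegral_eq_zero
      (f := fun t => g a' t c' - g a t c' - (g a' t c - g a t c)) (by fun_prop) hJo
      (fun b hb b' hb' => (main a ha a' ha' b hb b' hb' c hc c' hc').2.1) hb
  · exact eq_zero_of_forall_intervalIntegral_eq_zero
      (f := fun r => k a' b' r - k a b' r - (k a' b r - k a b r)) (by fun_prop) hLo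
      (fun c hc c' hc' => (main a ha a' ha' b hb b' hb' c hc c' hc').2.2) hc

/-- A continuous function taking values in a finite set almost everywhere on a preconnected open
set is constant there. -/
lemma exists_eq_of_ae_mem_finite {X : Type*} [TopologicalSpace X] [MeasurableSpace X]
    {μ : Measure X} [μ.IsOpenPosMeasure] {F : X → ℝ} (hF : Continuous F) {B : Set X}
    (hBo : IsOpen B) (hBc : IsPreconnected B) (hBn : B.Nonempty) {S : Set ℝ} (hS : S.Finite)
    (h : ∀ᵐ p ∂μ, p ∈ B → F p ∈ S) : ∃ c ∈ S, ∀ p ∈ B, F p = c := by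
  have hmem : ∀ p ∈ B, F p ∈ S := by
    intro p hp
    by_contra hn
    have hU : IsOpen (B ∩ F ⁻¹' Sᶜ) := hBo.inter (hS.isClosed.isOpen_compl.preimage hF)
    refine (hU.measure_pos μ ⟨p, hp, hn⟩).ne' (measure_mono_null ?_ (ae_iff.1 h))
    exact fun q hq hq' => hq.2 (hq' hq.1)
  obtain ⟨p₀, hp₀⟩ := hBn
  exact ⟨F p₀, hmem p₀ hp₀, fun p hp =>
    hBc.constant_of_mapsTo hS.isDiscrete hF.continuousOn hmem hp hp₀⟩

lemma finite_K3 (η₁ η₂ η₃ : ℝ) : (K3 η₁ η₂ η₃).Finite := by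
  unfold K3; exact Set.toFinite _

lemma eq_of_mem_K3_of_diag_eq {η₁ η₂ η₃ : ℝ} (h1 : η₂ < η₁) (h2 : η₁ < η₃)
    {A B : Matrix (Fin 3) (Fin 3) ℝ} (hA : A ∈ K3 η₁ η₂ η₃) (hB : B ∈ K3 η₁ η₂ η₃) (i : Fin 3)
    (h : A i i = B i i) : A = B := by
  rcases hA with rfl | rfl | rfl <;> rcases hB with rfl | rfl | rfl <;> first
    | rfl
    | (exfalso; fin_cases i <;> simp [well3] at h <;> linarith)

lemma diag_mem_of_mem_K3 {η₁ η₂ η₃ : ℝ} {A : Matrix (Fin 3) (Fin 3) ℝ} (hA : A ∈ K3 η₁ η₂ η₃)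
    (i : Fin 3) : A i i = η₁ ∨ A i i = η₂ ∨ A i i = η₃ := by
  rcases hA with rfl | rfl | rfl <;> fin_cases i <;> simp [well3]

lemma off_diag_eq_zero_of_mem_K3 {η₁ η₂ η₃ : ℝ} {A : Matrix (Fin 3) (Fin 3) ℝ}
    (hA : A ∈ K3 η₁ η₂ η₃) {i j : Fin 3} (hij : i ≠ j) : A i j = 0 := by
  rcases hA with rfl | rfl | rfl <;> simp [well3, hij]

/-- Since the three values of a diagonal entry are not in arithmetic progression, four wells whose
mixed difference vanishes on a square agree along one of the two directions. -/
lemma eq_and_eq_or_of_mixed_difference_eq_zero {η₁ η₂ η₃ : ℝ} (h1 : η₂ < η₁) (h2 : η₁ < η₃)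
    (h3 : 2 * η₁ < η₂ + η₃) {A B C D : Matrix (Fin 3) (Fin 3) ℝ} (hA : A ∈ K3 η₁ η₂ η₃)
    (hB : B ∈ K3 η₁ η₂ η₃) (hC : C ∈ K3 η₁ η₂ η₃) (hD : D ∈ K3 η₁ η₂ η₃) (i : Fin 3)
    (h : A i i - B i i - (C i i - D i i) = 0) : (A = B ∧ C = D) ∨ (A = C ∧ B = D) := by
  have key : (A i i = B i i ∧ C i i = D i i) ∨ (A i i = C i i ∧ B i i = D i i) := by
    rcases diag_mem_of_mem_K3 hA i with a | a | a <;>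
    rcases diag_mem_of_mem_K3 hB i with b | b | b <;>
    rcases diag_mem_of_mem_K3 hC i with c | c | c <;>
    rcases diag_mem_of_mem_K3 hD i with d | d | d <;>
    rw [a, b, c, d] at h ⊢ <;> first
      | exact Or.inl ⟨rfl, rfl⟩
      | exact Or.inr ⟨rfl, rfl⟩
      | (exfalso; linarith)
  exact key.imp
    (fun k => ⟨eq_of_mem_K3_of_diag_eq h1 h2 hA hB i k.1, eq_of_mem_K3_of_diag_eq h1 h2 hC hD i k.2⟩)
    (fun k => ⟨eq_of_mem_K3_of_diag_eq h1 h2 hA hC i k.1, eq_of_mem_K3_of_diag_eq h1 h2 hB hD i k.2⟩)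

lemma hasDerivAt_comp_line {u : V3 → V3} {γ : ℝ → V3} {v : V3}
    (hγ : ∀ s t, γ s = γ t + (s - t) • v) {t : ℝ} (hu : DifferentiableAt ℝ u (γ t)) (j : Fin 3) :
    HasDerivAt (fun s => u (γ s) j) (fderiv ℝ u (γ t) v j) t := by
  have h : HasDerivAt γ v t := by
    have : HasDerivAt (fun s => γ t + (s - t) • v) ((1 : ℝ) • v) t :=
      (((hasDerivAt_id t).sub_const t).smul_const v).const_add (γ t)
    rw [one_smul] at this
    exact this.congr_of_eventuallyEq (.of_forall fun s => hγ s t)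
  exact (EuclideanSpace.proj (𝕜 := ℝ) j).hasFDerivAt.comp_hasDerivAt t
    (hu.hasFDerivAt.comp_hasDerivAt t h)

lemma lipschitzWith_comp_line {u : V3 → V3} {K : NNReal} (hu : LipschitzWith K u) {γ : ℝ → V3}
    {v : V3} (hγ : ∀ s t, γ s = γ t + (s - t) • v) (hv : ‖v‖ = 1) (j : Fin 3) :
    LipschitzWith K (fun s => u (γ s) j) := by
  refine LipschitzWith.of_dist_le_mul fun s t => ?_
  calc dist (u (γ s) j) (u (γ t) j) ≤ dist (u (γ s)) (u (γ t)) := by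
        rw [dist_eq_norm, dist_eq_norm]
        exact PiLp.norm_apply_le (u (γ s) - u (γ t)) j
    _ ≤ K * dist (γ s) (γ t) := hu.dist_le_mul _ _
    _ = K * dist s t := by
        rw [hγ s t, dist_eq_norm, dist_eq_norm, add_sub_cancel_left, norm_smul, hv, mul_one]

/-- The point of `V3` with the given coordinates. -/
def pt (a b c : ℝ) : V3 := !₂[a, b, c]

lemma pt_line₁ (b c s t : ℝ) : pt s b c = pt t b c + (s - t) • EuclideanSpace.single 0 1 := by
  ext i; fin_cases i <;> simp [pt]

lemma pt_line₂ (a c s t : ℝ) : pt a s c = pt a t c + (s - t) • EuclideanSpace.single 1 1 := by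
  ext i; fin_cases i <;> simp [pt]

lemma pt_line₃ (a b s t : ℝ) : pt a b s = pt a b t + (s - t) • EuclideanSpace.single 2 1 := by
  ext i; fin_cases i <;> simp [pt]

lemma continuous_pt : Continuous fun p : ℝ × ℝ × ℝ => pt p.1 p.2.1 p.2.2 := by
  unfold pt
  fun_prop

lemma symGrad3_diag (u : V3 → V3) (x : V3) (i : Fin 3) :
    symGrad3 u x i i = fderiv ℝ u x (EuclideanSpace.single i 1) i := by
  simp [symGrad3]

/-- Mixed second differences of `u₃` in the first two variables and of `u₂` in the outer two vanish
on a box where `e(u)` is almost everywhere in `K₃`. -/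
lemma mixed_difference_eq_zero_of_mem_K3 {η₁ η₂ η₃ : ℝ} {u : V3 → V3} {K : NNReal}
    (hu : LipschitzWith K u) {I J L : Set ℝ} (hI : I.OrdConnected) (hJ : J.OrdConnected)
    (hL : L.OrdConnected) (hIo : IsOpen I) (hJo : IsOpen J) (hLo : IsOpen L)
    (h : ∀ᵐ p : ℝ × ℝ × ℝ, p.1 ∈ I → p.2.1 ∈ J → p.2.2 ∈ L →
      DifferentiableAt ℝ u (pt p.1 p.2.1 p.2.2) ∧
        symGrad3 u (pt p.1 p.2.1 p.2.2) ∈ K3 η₁ η₂ η₃) :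
    (∀ b ∈ J, ∀ a ∈ I, ∀ a' ∈ I, ∀ c ∈ L, ∀ c' ∈ L,
      u (pt a' b c') 1 - u (pt a b c') 1 - (u (pt a' b c) 1 - u (pt a b c) 1) = 0) ∧
    (∀ c ∈ L, ∀ a ∈ I, ∀ a' ∈ I, ∀ b ∈ J, ∀ b' ∈ J,
      u (pt a' b' c) 2 - u (pt a b' c) 2 - (u (pt a' b c) 2 - u (pt a b c) 2) = 0) := by
  have huc := hu.continuous.comp continuous_pt
  have hc (j : Fin 3) : Continuous fun p : ℝ × ℝ × ℝ => u (pt p.1 p.2.1 p.2.2) j :=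
    (EuclideanSpace.proj (𝕜 := ℝ) j).continuous.comp huc
  have l₁ (j : Fin 3) (b c : ℝ) := lipschitzWith_comp_line hu (pt_line₁ b c) (by simp) j
  have l₂ (j : Fin 3) (a c : ℝ) := lipschitzWith_comp_line hu (pt_line₂ a c) (by simp) j
  have l₃ (j : Fin 3) (a b : ℝ) := lipschitzWith_comp_line hu (pt_line₃ a b) (by simp) j
  refine (mixed_difference_eq_zero (l₂ 0) (l₃ 0) (l₁ 1) (l₃ 1) (l₁ 2) (l₂ 2) (hc 0) (hc 1) (hc 2)
    hI hJ hL hIo hJo hLo ?_).2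
  filter_upwards [h] with p hp ha hb hc
  obtain ⟨hd, hK⟩ := hp ha hb hc
  rw [(hasDerivAt_comp_line (pt_line₁ _ _) hd _).deriv,
    (hasDerivAt_comp_line (pt_line₁ _ _) hd _).deriv,
    (hasDerivAt_comp_line (pt_line₂ _ _) hd _).deriv,
    (hasDerivAt_comp_line (pt_line₂ _ _) hd _).deriv,
    (hasDerivAt_comp_line (pt_line₃ _ _) hd _).deriv,
    (hasDerivAt_comp_line (pt_line₃ _ _) hd _).deriv]
  have e₁ := off_diag_eq_zero_of_mem_K3 hK (i := 0) (j := 1) (by decide)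
  have e₂ := off_diag_eq_zero_of_mem_K3 hK (i := 0) (j := 2) (by decide)
  have e₃ := off_diag_eq_zero_of_mem_K3 hK (i := 1) (j := 2) (by decide)
  simp only [symGrad3] at e₁ e₂ e₃
  refine ⟨?_, ?_, ?_⟩ <;> linarith

/-- Four strains at the corners of a square orthogonal to the second axis. -/
lemma square_alternative₂ {η₁ η₂ η₃ : ℝ} (h1 : η₂ < η₁) (h2 : η₁ < η₃)
    (h3 : 2 * η₁ < η₂ + η₃) {u : V3 → V3} {J : Set ℝ} (hJ : IsOpen J) {a a' b c c' : ℝ}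
    (hb : b ∈ J) (hmix : ∀ b ∈ J,
      u (pt a' b c') 1 - u (pt a b c') 1 - (u (pt a' b c) 1 - u (pt a b c) 1) = 0)
    (h₁ : DifferentiableAt ℝ u (pt a' b c') ∧ symGrad3 u (pt a' b c') ∈ K3 η₁ η₂ η₃)
    (h₂ : DifferentiableAt ℝ u (pt a b c') ∧ symGrad3 u (pt a b c') ∈ K3 η₁ η₂ η₃)
    (h₃ : DifferentiableAt ℝ u (pt a' b c) ∧ symGrad3 u (pt a' b c) ∈ K3 η₁ η₂ η₃)
    (h₄ : DifferentiableAt ℝ u (pt a b c) ∧ symGrad3 u (pt a b c) ∈ K3 η₁ η₂ η₃) :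
    (symGrad3 u (pt a' b c') = symGrad3 u (pt a b c') ∧
        symGrad3 u (pt a' b c) = symGrad3 u (pt a b c)) ∨
      (symGrad3 u (pt a' b c') = symGrad3 u (pt a' b c) ∧
        symGrad3 u (pt a b c') = symGrad3 u (pt a b c)) := by
  refine eq_and_eq_or_of_mixed_difference_eq_zero h1 h2 h3 h₁.2 h₂.2 h₃.2 h₄.2 1 ?_
  simp only [symGrad3_diag]
  have hd := ((hasDerivAt_comp_line (pt_line₂ a' c') h₁.1 1).sub
    (hasDerivAt_comp_line (pt_line₂ a c') h₂.1 1)).sub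
    ((hasDerivAt_comp_line (pt_line₂ a' c) h₃.1 1).sub
    (hasDerivAt_comp_line (pt_line₂ a c) h₄.1 1))
  exact hd.unique ((hasDerivAt_const b (0 : ℝ)).congr_of_eventuallyEq
    (Filter.eventually_of_mem (hJ.mem_nhds hb) hmix))

/-- Four strains at the corners of a square orthogonal to the third axis. -/
lemma square_alternative₃ {η₁ η₂ η₃ : ℝ} (h1 : η₂ < η₁) (h2 : η₁ < η₃)
    (h3 : 2 * η₁ < η₂ + η₃) {u : V3 → V3} {L : Set ℝ} (hL : IsOpen L) {a a' b b' c : ℝ}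
    (hc : c ∈ L) (hmix : ∀ c ∈ L,
      u (pt a' b' c) 2 - u (pt a b' c) 2 - (u (pt a' b c) 2 - u (pt a b c) 2) = 0)
    (h₁ : DifferentiableAt ℝ u (pt a' b' c) ∧ symGrad3 u (pt a' b' c) ∈ K3 η₁ η₂ η₃)
    (h₂ : DifferentiableAt ℝ u (pt a b' c) ∧ symGrad3 u (pt a b' c) ∈ K3 η₁ η₂ η₃)
    (h₃ : DifferentiableAt ℝ u (pt a' b c) ∧ symGrad3 u (pt a' b c) ∈ K3 η₁ η₂ η₃)
    (h₄ : DifferentiableAt ℝ u (pt a b c) ∧ symGrad3 u (pt a b c) ∈ K3 η₁ η₂ η₃) :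
    (symGrad3 u (pt a' b' c) = symGrad3 u (pt a b' c) ∧
        symGrad3 u (pt a' b c) = symGrad3 u (pt a b c)) ∨
      (symGrad3 u (pt a' b' c) = symGrad3 u (pt a' b c) ∧
        symGrad3 u (pt a b' c) = symGrad3 u (pt a b c)) := by
  refine eq_and_eq_or_of_mixed_difference_eq_zero h1 h2 h3 h₁.2 h₂.2 h₃.2 h₄.2 2 ?_
  simp only [symGrad3_diag]
  have hd := ((hasDerivAt_comp_line (pt_line₃ a' b') h₁.1 2).sub
    (hasDerivAt_comp_line (pt_line₃ a b') h₂.1 2)).sub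
    ((hasDerivAt_comp_line (pt_line₃ a' b) h₃.1 2).sub
    (hasDerivAt_comp_line (pt_line₃ a b) h₄.1 2))
  exact hd.unique ((hasDerivAt_const c (0 : ℝ)).congr_of_eventuallyEq
    (Filter.eventually_of_mem (hL.mem_nhds hc) hmix))

/-- Almost everywhere on a box, the strain is independent of the first or of the second
variable. -/
lemma ae_eq_or_ae_eq_of_mem_K3 {η₁ η₂ η₃ : ℝ} (h1 : η₂ < η₁) (h2 : η₁ < η₃)
    (h3 : 2 * η₁ < η₂ + η₃) {u : V3 → V3} {K : NNReal}
    (hu : LipschitzWith K u) {I J L : Set ℝ} (hI : I.OrdConnected) (hJ : J.OrdConnected)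
    (hL : L.OrdConnected) (hIo : IsOpen I) (hJo : IsOpen J) (hLo : IsOpen L)
    (h : ∀ᵐ p : ℝ × ℝ × ℝ, p.1 ∈ I → p.2.1 ∈ J → p.2.2 ∈ L →
      DifferentiableAt ℝ u (pt p.1 p.2.1 p.2.2) ∧
        symGrad3 u (pt p.1 p.2.1 p.2.2) ∈ K3 η₁ η₂ η₃) :
    (∀ᵐ p : (ℝ × ℝ × ℝ) × ℝ, p.1.1 ∈ I → p.1.2.1 ∈ J → p.1.2.2 ∈ L → p.2 ∈ I →
      symGrad3 u (pt p.2 p.1.2.1 p.1.2.2) = symGrad3 u (pt p.1.1 p.1.2.1 p.1.2.2)) ∨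
    (∀ᵐ p : (ℝ × ℝ × ℝ) × ℝ, p.1.1 ∈ I → p.1.2.1 ∈ J → p.1.2.2 ∈ L → p.2 ∈ J →
      symGrad3 u (pt p.1.1 p.2 p.1.2.2) = symGrad3 u (pt p.1.1 p.1.2.1 p.1.2.2)) := by
  obtain ⟨m₂, m₃⟩ := mixed_difference_eq_zero_of_mem_K3 hu hI hJ hL hIo hJo hLo h
  have hμ : (volume : Measure ((ℝ × ℝ × ℝ) × ℝ)).IsAddHaarMeasure := inferInstance
  have hμμ : (volume : Measure (((ℝ × ℝ × ℝ) × ℝ) × ((ℝ × ℝ × ℝ) × ℝ))).IsAddHaarMeasure :=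
    inferInstance
  have comp (f : ((ℝ × ℝ × ℝ) × ℝ) × ((ℝ × ℝ × ℝ) × ℝ) → ℝ × ℝ × ℝ) (hf : IsLinearMap ℝ f)
      (hs : Function.Surjective f) := ae_comp_of_isLinearMap h f hf hs
  have key : ∀ᵐ z : ((ℝ × ℝ × ℝ) × ℝ) × ((ℝ × ℝ × ℝ) × ℝ),
      ¬ (z.1.1.1 ∈ I → z.1.1.2.1 ∈ J → z.1.1.2.2 ∈ L → z.1.2 ∈ I →
        symGrad3 u (pt z.1.2 z.1.1.2.1 z.1.1.2.2) =
          symGrad3 u (pt z.1.1.1 z.1.1.2.1 z.1.1.2.2)) →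
      (z.2.1.1 ∈ I → z.2.1.2.1 ∈ J → z.2.1.2.2 ∈ L → z.2.2 ∈ J →
        symGrad3 u (pt z.2.1.1 z.2.2 z.2.1.2.2) =
          symGrad3 u (pt z.2.1.1 z.2.1.2.1 z.2.1.2.2)) := by
    filter_upwards [
      comp (fun z => (z.1.1.1, z.1.1.2.1, z.1.1.2.2)) ⟨fun _ _ => rfl, fun _ _ => rfl⟩
        fun y => ⟨((y, y.1), (y, y.2.1)), rfl⟩,
      comp (fun z => (z.1.2, z.1.1.2.1, z.1.1.2.2)) ⟨fun _ _ => rfl, fun _ _ => rfl⟩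
        fun y => ⟨((y, y.1), (y, y.2.1)), rfl⟩,
      comp (fun z => (z.1.1.1, z.2.1.2.1, z.1.1.2.2)) ⟨fun _ _ => rfl, fun _ _ => rfl⟩
        fun y => ⟨((y, y.1), (y, y.2.1)), rfl⟩,
      comp (fun z => (z.1.2, z.2.1.2.1, z.1.1.2.2)) ⟨fun _ _ => rfl, fun _ _ => rfl⟩
        fun y => ⟨((y, y.1), (y, y.2.1)), rfl⟩,
      comp (fun z => (z.1.1.1, z.2.1.2.1, z.2.1.2.2)) ⟨fun _ _ => rfl, fun _ _ => rfl⟩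
        fun y => ⟨((y, y.1), (y, y.2.1)), rfl⟩,
      comp (fun z => (z.1.2, z.2.1.2.1, z.2.1.2.2)) ⟨fun _ _ => rfl, fun _ _ => rfl⟩
        fun y => ⟨((y, y.1), (y, y.2.1)), rfl⟩,
      comp (fun z => (z.1.1.1, z.2.2, z.2.1.2.2)) ⟨fun _ _ => rfl, fun _ _ => rfl⟩
        fun y => ⟨((y, y.1), (y, y.2.1)), rfl⟩,
      comp (fun z => (z.1.2, z.2.2, z.2.1.2.2)) ⟨fun _ _ => rfl, fun _ _ => rfl⟩
        fun y => ⟨((y, y.1), (y, y.2.1)), rfl⟩,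
      comp (fun z => (z.2.1.1, z.2.1.2.1, z.2.1.2.2)) ⟨fun _ _ => rfl, fun _ _ => rfl⟩
        fun y => ⟨((y, y.1), (y, y.2.1)), rfl⟩,
      comp (fun z => (z.2.1.1, z.2.2, z.2.1.2.2)) ⟨fun _ _ => rfl, fun _ _ => rfl⟩
        fun y => ⟨((y, y.1), (y, y.2.1)), rfl⟩]
    rintro ⟨⟨⟨a, b, c⟩, a'⟩, ⟨⟨α, β, γ⟩, β'⟩⟩ g₁ g₂ g₃ g₄ g₅ g₆ g₇ g₈ g₉ g₁₀ hne hα hβ hγ hβ'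
    dsimp only at *
    push Not at hne
    obtain ⟨ha, hb, hc, ha', hne⟩ := hne
    have s₁ := square_alternative₃ h1 h2 h3 hLo hc (fun c hc => m₃ c hc a ha a' ha' b hb β hβ)
      (g₄ ha' hβ hc) (g₃ ha hβ hc) (g₂ ha' hb hc) (g₁ ha hb hc)
    have s₂ := square_alternative₂ h1 h2 h3 hJo hβ (fun b hb => m₂ b hb a ha a' ha' c hc γ hγ)
      (g₆ ha' hβ hγ) (g₅ ha hβ hγ) (g₄ ha' hβ hc) (g₃ ha hβ hc)
    have s₃ := square_alternative₃ h1 h2 h3 hLo hγ (fun c hc => m₃ c hc a ha a' ha' β hβ β' hβ')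
      (g₈ ha' hβ' hγ) (g₇ ha hβ' hγ) (g₆ ha' hβ hγ) (g₅ ha hβ hγ)
    have s₄ := square_alternative₃ h1 h2 h3 hLo hγ (fun c hc => m₃ c hc a ha α hα β hβ β' hβ')
      (g₁₀ hα hβ' hγ) (g₇ ha hβ' hγ) (g₉ hα hβ hγ) (g₅ ha hβ hγ)
    clear * - s₁ s₂ s₃ s₄ hne
    grind
  by_contra hcon
  obtain ⟨hn₁, hn₂⟩ := not_or.1 hcon
  refine hn₁ ?_
  filter_upwards [Measure.ae_ae_of_ae_prod key] with p hp
  refine by_contra fun hbad => hn₂ ?_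
  filter_upwards [hp] with q hq using hq hbad

lemma exists_ae_eq_of_continuous_diag {η₁ η₂ η₃ : ℝ} (h1 : η₂ < η₁) (h2 : η₁ < η₃)
    {X : Type*} [TopologicalSpace X] [MeasurableSpace X]
    {μ : Measure X} [μ.IsOpenPosMeasure] {F : X → ℝ} (hF : Continuous F) {B : Set X}
    (hBo : IsOpen B) (hBc : IsPreconnected B) (hBn : B.Nonempty) {τ : ℝ} (hτ : τ ≠ 0)
    {E : X → Matrix (Fin 3) (Fin 3) ℝ} {i : Fin 3}
    (h : ∀ᵐ p ∂μ, p ∈ B → E p ∈ K3 η₁ η₂ η₃ ∧ F p = τ * E p i i) :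
    ∃ w, ∀ᵐ p ∂μ, p ∈ B → E p = w := by
  obtain ⟨_, ⟨w, hw, rfl⟩, hFw⟩ := exists_eq_of_ae_mem_finite (μ := μ) hF hBo hBc hBn
    ((finite_K3 η₁ η₂ η₃).image fun A => τ * A i i) (by
      filter_upwards [h] with p hp hpB
      exact ⟨E p, (hp hpB).1, (hp hpB).2.symm⟩)
  refine ⟨w, ?_⟩
  filter_upwards [h] with p hp hpB
  refine eq_of_mem_K3_of_diag_eq h1 h2 (hp hpB).1 hw i ?_
  exact mul_left_cancel₀ hτ ((hp hpB).2.symm.trans (hFw p hpB))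

/-- If the strain does not depend on the position along a line, the increment of the corresponding
component is the strain times the length. -/
lemma sub_eq_mul_of_ae_eq {u : V3 → V3} {K : NNReal} (hu : LipschitzWith K u) {γ : ℝ → V3}
    {i : Fin 3} (hγ : ∀ s t, γ s = γ t + (s - t) • EuclideanSpace.single i 1) {a b e : ℝ}
    (h : ∀ᵐ s, s ∈ Set.uIoc a b → DifferentiableAt ℝ u (γ s) ∧ symGrad3 u (γ s) i i = e) :
    u (γ b) i - u (γ a) i = (b - a) * e := by
  rw [← (lipschitzWith_comp_line hu hγ (by simp) i).intervalIntegral_deriv a b]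
  have : ∫ s in a..b, deriv (fun s => u (γ s) i) s = ∫ _ in a..b, e := by
    refine intervalIntegral.integral_congr_ae ?_
    filter_upwards [h] with s hs hsI
    obtain ⟨hd, he⟩ := hs hsI
    rw [(hasDerivAt_comp_line hγ hd i).deriv, ← symGrad3_diag, he]
  rw [this, intervalIntegral.integral_const, smul_eq_mul]

/-- On a box, the strain is almost everywhere constant. -/
lemma exists_ae_eq_on_box {η₁ η₂ η₃ : ℝ} (h1 : η₂ < η₁) (h2 : η₁ < η₃)
    (h3 : 2 * η₁ < η₂ + η₃) {u : V3 → V3} {K : NNReal} (hu : LipschitzWith K u)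
    {l₁ r₁ l₂ r₂ l₃ r₃ : ℝ} (hlr₁ : l₁ < r₁) (hlr₂ : l₂ < r₂) (hlr₃ : l₃ < r₃)
    (h : ∀ᵐ p : ℝ × ℝ × ℝ, p.1 ∈ Set.Ioo l₁ r₁ → p.2.1 ∈ Set.Ioo l₂ r₂ → p.2.2 ∈ Set.Ioo l₃ r₃ →
      DifferentiableAt ℝ u (pt p.1 p.2.1 p.2.2) ∧
        symGrad3 u (pt p.1 p.2.1 p.2.2) ∈ K3 η₁ η₂ η₃) :
    ∃ w, ∀ᵐ p : ℝ × ℝ × ℝ, p ∈ Set.Ioo l₁ r₁ ×ˢ Set.Ioo l₂ r₂ ×ˢ Set.Ioo l₃ r₃ →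
      symGrad3 u (pt p.1 p.2.1 p.2.2) = w := by
  have hBo : IsOpen (Set.Ioo l₁ r₁ ×ˢ Set.Ioo l₂ r₂ ×ˢ Set.Ioo l₃ r₃) :=
    isOpen_Ioo.prod (isOpen_Ioo.prod isOpen_Ioo)
  have hBc : IsPreconnected (Set.Ioo l₁ r₁ ×ˢ Set.Ioo l₂ r₂ ×ˢ Set.Ioo l₃ r₃) :=
    isPreconnected_Ioo.prod (isPreconnected_Ioo.prod isPreconnected_Ioo)
  have hBn : (Set.Ioo l₁ r₁ ×ˢ Set.Ioo l₂ r₂ ×ˢ Set.Ioo l₃ r₃).Nonempty :=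
    (Set.nonempty_Ioo.2 hlr₁).prod ((Set.nonempty_Ioo.2 hlr₂).prod (Set.nonempty_Ioo.2 hlr₃))
  have huc (j : Fin 3) : Continuous fun x => u x j :=
    (EuclideanSpace.proj (𝕜 := ℝ) j).continuous.comp hu.continuous
  have hpt : Continuous ↿pt := continuous_pt
  rcases ae_eq_or_ae_eq_of_mem_K3 h1 h2 h3 hu Set.ordConnected_Ioo Set.ordConnected_Ioo
    Set.ordConnected_Ioo isOpen_Ioo isOpen_Ioo isOpen_Ioo h with H | H
  · obtain ⟨t₀, ht₀, ht₀'⟩ := exists_between hlr₁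
    obtain ⟨t₁, ht₁, ht₁'⟩ := exists_between ht₀'
    refine exists_ae_eq_of_continuous_diag h1 h2 (i := 0) (τ := t₁ - t₀)
      (F := fun p => u (pt t₁ p.2.1 p.2.2) 0 - u (pt t₀ p.2.1 p.2.2) 0)
      (((huc 0).comp (by fun_prop)).sub ((huc 0).comp (by fun_prop))) hBo hBc hBn
      (sub_ne_zero.2 ht₁.ne') ?_
    have hG := ae_comp_of_isLinearMap h
      (fun p : (ℝ × ℝ × ℝ) × ℝ => (p.2, p.1.2.1, p.1.2.2)) ⟨fun _ _ => rfl, fun _ _ => rfl⟩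
      fun y => ⟨(y, y.1), rfl⟩
    filter_upwards [h, Measure.ae_ae_of_ae_prod H, Measure.ae_ae_of_ae_prod hG]
      with p hp hH hG ⟨hp₁, hp₂, hp₃⟩
    refine ⟨(hp hp₁ hp₂ hp₃).2,
      sub_eq_mul_of_ae_eq hu (pt_line₁ p.2.1 p.2.2) ?_⟩
    filter_upwards [hH, hG] with s hs hsG hsI
    rw [Set.uIoc_of_le ht₁.le] at hsI
    have hsI' : s ∈ Set.Ioo l₁ r₁ := ⟨ht₀.trans hsI.1, hsI.2.trans_lt ht₁'⟩
    exact ⟨(hsG hsI' hp₂ hp₃).1, by rw [hs hp₁ hp₂ hp₃ hsI']⟩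
  · obtain ⟨t₀, ht₀, ht₀'⟩ := exists_between hlr₂
    obtain ⟨t₁, ht₁, ht₁'⟩ := exists_between ht₀'
    refine exists_ae_eq_of_continuous_diag h1 h2 (i := 1) (τ := t₁ - t₀)
      (F := fun p => u (pt p.1 t₁ p.2.2) 1 - u (pt p.1 t₀ p.2.2) 1)
      (((huc 1).comp (by fun_prop)).sub ((huc 1).comp (by fun_prop))) hBo hBc hBn
      (sub_ne_zero.2 ht₁.ne') ?_
    have hG := ae_comp_of_isLinearMap h
      (fun p : (ℝ × ℝ × ℝ) × ℝ => (p.1.1, p.2, p.1.2.2)) ⟨fun _ _ => rfl, fun _ _ => rfl⟩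
      fun y => ⟨(y, y.2.1), rfl⟩
    filter_upwards [h, Measure.ae_ae_of_ae_prod H, Measure.ae_ae_of_ae_prod hG]
      with p hp hH hG ⟨hp₁, hp₂, hp₃⟩
    refine ⟨(hp hp₁ hp₂ hp₃).2,
      sub_eq_mul_of_ae_eq hu (pt_line₂ p.1 p.2.2) ?_⟩
    filter_upwards [hH, hG] with s hs hsG hsI
    rw [Set.uIoc_of_le ht₁.le] at hsI
    have hsI' : s ∈ Set.Ioo l₂ r₂ := ⟨ht₀.trans hsI.1, hsI.2.trans_lt ht₁'⟩
    exact ⟨(hsG hp₁ hsI' hp₃).1, by rw [hs hp₁ hp₂ hp₃ hsI']⟩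

/-- Every point of an open set on which `e(u)` is almost everywhere in `K₃` has an open
neighbourhood where the strain is almost everywhere constant. -/
lemma exists_isOpen_ae_eq {η₁ η₂ η₃ : ℝ} (h1 : η₂ < η₁) (h2 : η₁ < η₃)
    (h3 : 2 * η₁ < η₂ + η₃) {u : V3 → V3} {K : NNReal} (hu : LipschitzWith K u)
    {Ω : Set V3} (hΩ : IsOpen Ω) (h : ∀ᵐ x, x ∈ Ω → symGrad3 u x ∈ K3 η₁ η₂ η₃) {x : V3}
    (hx : x ∈ Ω) : ∃ w, ∃ U, IsOpen U ∧ x ∈ U ∧ ∀ᵐ y, y ∈ U → symGrad3 u y = w := by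
  have hpt (y : V3) : pt (y 0) (y 1) (y 2) = y := by
    ext i; fin_cases i <;> simp [pt]
  have hc : Continuous fun p : ℝ × ℝ × ℝ => pt p.1 p.2.1 p.2.2 := continuous_pt
  obtain ⟨r, hr, hball⟩ := Metric.isOpen_iff.1 (hΩ.preimage hc) (x 0, x 1, x 2)
    (by rw [Set.mem_preimage, hpt]; exact hx)
  have hbox : ∀ p : ℝ × ℝ × ℝ, p.1 ∈ Set.Ioo (x 0 - r) (x 0 + r) →
      p.2.1 ∈ Set.Ioo (x 1 - r) (x 1 + r) → p.2.2 ∈ Set.Ioo (x 2 - r) (x 2 + r) →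
      pt p.1 p.2.1 p.2.2 ∈ Ω := by
    rintro ⟨a, b, c⟩ ha hb hc
    rw [← Real.ball_eq_Ioo] at ha hb hc
    refine hball ?_
    rw [← ball_prod_same, ← ball_prod_same]
    exact ⟨ha, hb, hc⟩
  have hG : ∀ᵐ y, y ∈ Ω → DifferentiableAt ℝ u y ∧ symGrad3 u y ∈ K3 η₁ η₂ η₃ := by
    filter_upwards [h, hu.ae_differentiableAt] with y hy hd hyΩ using ⟨hd, hy hyΩ⟩
  have hG' := ae_comp_of_isLinearMap hG (fun p : ℝ × ℝ × ℝ => pt p.1 p.2.1 p.2.2)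
    ⟨fun p q => by ext i; fin_cases i <;> simp [pt], fun c p => by
      ext i; fin_cases i <;> simp [pt]⟩ fun y => ⟨(y 0, y 1, y 2), hpt y⟩
  obtain ⟨w, hw⟩ := exists_ae_eq_on_box h1 h2 h3 hu (l₁ := x 0 - r) (r₁ := x 0 + r)
    (l₂ := x 1 - r) (r₂ := x 1 + r) (l₃ := x 2 - r) (r₃ := x 2 + r)
    (by linarith) (by linarith) (by linarith) (by
      filter_upwards [hG'] with p hp ha hb hc using hp (hbox p ha hb hc))
  have hcoord : Continuous fun y : V3 => (y 0, y 1, y 2) := by fun_prop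
  refine ⟨w, (fun y : V3 => (y 0, y 1, y 2)) ⁻¹' (Set.Ioo (x 0 - r) (x 0 + r) ×ˢ
    Set.Ioo (x 1 - r) (x 1 + r) ×ˢ Set.Ioo (x 2 - r) (x 2 + r)),
    (isOpen_Ioo.prod (isOpen_Ioo.prod isOpen_Ioo)).preimage hcoord, ?_, ?_⟩
  · refine ⟨⟨?_, ?_⟩, ⟨?_, ?_⟩, ⟨?_, ?_⟩⟩ <;> dsimp only <;> linarith
  · have := ae_comp_of_isLinearMap hw (fun y : V3 => (y 0, y 1, y 2))
      ⟨fun _ _ => rfl, fun _ _ => rfl⟩ fun p => ⟨pt p.1 p.2.1 p.2.2, by simp [pt]⟩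
    filter_upwards [this] with y hy hyU
    rw [← hy hyU, hpt]

/-- On a preconnected set, a function which is locally almost everywhere constant is almost
everywhere constant. -/
lemma exists_ae_eq_of_locally {X Y : Type*} [TopologicalSpace X] [SecondCountableTopology X]
    [MeasurableSpace X] {μ : Measure X} [μ.IsOpenPosMeasure] {Ω : Set X} (hΩ : IsPreconnected Ω)
    (hne : Ω.Nonempty) {f : X → Y}
    (h : ∀ x ∈ Ω, ∃ w, ∃ U, IsOpen U ∧ x ∈ U ∧ ∀ᵐ y ∂μ, y ∈ U → f y = w) :
    ∃ w, ∀ᵐ y ∂μ, y ∈ Ω → f y = w := by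
  obtain ⟨x₀, hx₀⟩ := hne
  obtain ⟨w, U₀, hU₀, hxU₀, hw₀⟩ := h x₀ hx₀
  let V : Set X := ⋃₀ {U | IsOpen U ∧ ∀ᵐ y ∂μ, y ∈ U → f y = w}
  let W : Set X := ⋃₀ {U | IsOpen U ∧ ∃ w' ≠ w, ∀ᵐ y ∂μ, y ∈ U → f y = w'}
  have hVW : Disjoint V W := by
    rw [Set.disjoint_left]
    rintro x ⟨U, ⟨hU, hUw⟩, hxU⟩ ⟨U', ⟨hU', w', hne, hUw'⟩, hxU'⟩
    refine ((hU.inter hU').measure_pos μ ⟨x, hxU, hxU'⟩).ne' ?_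
    rw [measure_eq_zero_iff_ae_notMem]
    filter_upwards [hUw, hUw'] with y hy hy' hyU
    exact hne ((hy' hyU.2).symm.trans (hy hyU.1))
  have hsub : Ω ⊆ V := by
    refine IsPreconnected.subset_left_of_subset_union (isOpen_sUnion fun U hU => hU.1)
      (isOpen_sUnion fun U hU => hU.1) hVW (fun x hx => ?_)
      ⟨x₀, hx₀, U₀, ⟨hU₀, hw₀⟩, hxU₀⟩ hΩ
    obtain ⟨w', U, hU, hxU, hw'⟩ := h x hx
    by_cases hww : w' = w
    · exact Or.inl ⟨U, ⟨hU, hww ▸ hw'⟩, hxU⟩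
    · exact Or.inr ⟨U, ⟨hU, w', hww, hw'⟩, hxU⟩
  refine ⟨w, ?_⟩
  rw [ae_iff]
  refine measure_null_of_locally_null _ fun x hx => ?_
  simp only [Set.mem_ofPred_eq, Classical.not_imp] at hx
  obtain ⟨U, ⟨hU, hUw⟩, hxU⟩ := hsub hx.1
  refine ⟨_, Filter.inter_mem self_mem_nhdsWithin (mem_nhdsWithin_of_mem_nhds (hU.mem_nhds hxU)),
    measure_mono_null ?_ (ae_iff.1 hUw)⟩
  rintro y ⟨hy, hyU⟩ hy'
  exact hy fun _ => hy' hyU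

/-- rigidity of the exact inclusion `e(u) ∈ K₃`: the diagonal strain components
are constant. -/
theorem stmt5 (η₁ η₂ η₃ : ℝ) (h1 : η₂ < η₁) (h2 : η₁ < η₃) (h3 : 2 * η₁ < η₂ + η₃)
    (Ω : Set V3) (hΩo : IsOpen Ω) (hΩb : Bornology.IsBounded Ω)
    (hΩc : IsConnected Ω) (hΩsc : SimplyConnectedSpace Ω)
    (u : V3 → V3) (K : NNReal) (hu : LipschitzWith K u)
    (hincl : ∀ᵐ x ∂volume.restrict Ω, symGrad3 u x ∈ K3 η₁ η₂ η₃) :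
    ∃ c : Fin 3 → ℝ, ∀ᵐ x ∂volume.restrict Ω, ∀ j : Fin 3, symGrad3 u x j j = c j := by
  obtain ⟨w, hw⟩ := exists_ae_eq_of_locally hΩc.isPreconnected hΩc.nonempty
    fun x hx => exists_isOpen_ae_eq h1 h2 h3 hu hΩo
      ((ae_restrict_iff' hΩo.measurableSet).1 hincl) hx
  refine ⟨fun j => w j j, (ae_restrict_iff' hΩo.measurableSet).2 ?_⟩
  filter_upwards [hw] with x hx hxΩ j
  rw [hx hxΩ]
end
end

section
/- Let b ∈ L¹_loc(ℝ²) satisfy, for every smooth compactly supported test function φ: ℝ² → ℝ, ∫_{ℝ²} b(x) ∂₁∂₂φ(x) dx = 0 and ∫_{ℝ²} b(x) (∂₁²φ(x) − ∂₂²φ(x)) dx = 0. Then b coincides almost everywhere with a polynomial in the two variables x₁, x₂ of total degree at most 2. -/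
open MeasureTheory

noncomputable section

/-- Second distributional partial derivative pairing: `∫ b ∂ᵢ∂ⱼφ`. -/
def pairing2 (b : (Fin 2 → ℝ) → ℝ) (φ : (Fin 2 → ℝ) → ℝ) (i j : Fin 2) : ℝ :=
  ∫ x, b x * fderiv ℝ (fun y => fderiv ℝ φ y (Pi.single i 1)) x (Pi.single j 1)

/-- A function of two real variables whose mixed second derivative vanishes and whose two pure
second derivatives agree is a quadratic polynomial. -/
theorem eq_quadratic_of_hasDerivAt {F P Q R : ℝ → ℝ → ℝ}
    (hP : ∀ x y, HasDerivAt (fun s => F s y) (P x y) x)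
    (hQ : ∀ x y, HasDerivAt (fun s => F x s) (Q x y) y)
    (hPx : ∀ x y, HasDerivAt (fun s => P s y) (R x y) x)
    (hPy : ∀ x y, HasDerivAt (fun s => P x s) 0 y)
    (hQy : ∀ x y, HasDerivAt (fun s => Q x s) (R x y) y) (x y : ℝ) :
    F x y = F 0 0 + P 0 0 * x + Q 0 0 * y + R 0 0 / 2 * (x ^ 2 + y ^ 2) := by
  have const_of {f : ℝ → ℝ} (hf : ∀ x, HasDerivAt f 0 x) (a b : ℝ) : f a = f b :=
    is_const_of_deriv_eq_zero (fun x => (hf x).differentiableAt) (fun x => (hf x).deriv) a b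
  have P_eq (x y : ℝ) : P x y = P x 0 := const_of (hPy x) y 0
  have F_eq (x y : ℝ) : F x y - F x 0 = F 0 y - F 0 0 :=
    const_of (f := fun s => F s y - F s 0)
      (fun s => ((hP s y).sub (hP s 0)).congr_deriv (by rw [P_eq s y, sub_self])) x 0
  have Q_eq (x y : ℝ) : Q x y = Q 0 y := by
    have h : (fun s => F x s) = fun s => F 0 s + (F x 0 - F 0 0) :=
      funext fun s => by linarith [F_eq x s]
    exact (h ▸ hQ x y).unique ((hQ 0 y).add_const _)
  have R_eq_x (x y : ℝ) : R x y = R x 0 := by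
    have h : (fun s => P s y) = fun s => P s 0 := funext fun s => P_eq s y
    exact (h ▸ hPx x y).unique (hPx x 0)
  have R_eq_y (x y : ℝ) : R x y = R 0 y := by
    have h : (fun s => Q x s) = fun s => Q 0 s := funext fun s => Q_eq x s
    exact (h ▸ hQy x y).unique (hQy 0 y)
  have R_eq (x y : ℝ) : R x y = R 0 0 := (R_eq_x x y).trans (R_eq_y x 0)
  have taylor {f f' : ℝ → ℝ} (hf : ∀ t, HasDerivAt f (f' t) t)
      (hf' : ∀ t, HasDerivAt f' (R 0 0) t) (t : ℝ) :
      f t = f 0 + f' 0 * t + R 0 0 / 2 * t ^ 2 := by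
    have hlin (t : ℝ) : f' t = f' 0 + R 0 0 * t := by
      have := const_of (f := fun t => f' t - R 0 0 * t)
        (fun t => ((hf' t).sub ((hasDerivAt_id t).const_mul (R 0 0))).congr_deriv (by ring)) t 0
      linarith
    have := const_of (f := fun t => f t - (f' 0 * t + R 0 0 / 2 * t ^ 2))
      (fun t => ((hf t).sub (((hasDerivAt_id t).const_mul (f' 0)).add
        ((hasDerivAt_pow 2 t).const_mul (R 0 0 / 2)))).congr_deriv (by rw [hlin t]; push_cast; ring))
      t 0
    linarith
  have hx := taylor (fun t => hP t 0) (fun t => (hPx t 0).congr_deriv (R_eq t 0)) x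
  have hy := taylor (fun t => hQ 0 t) (fun t => (hQy 0 t).congr_deriv (R_eq 0 t)) y
  linarith [F_eq x y]

open scoped Convolution in
/-- A directional derivative of a convolution falls on the smooth factor. -/
theorem hasFDerivAt_convolution_lsmul {E : Type*} [NormedAddCommGroup E] [NormedSpace ℝ E]
    [MeasurableSpace E] [BorelSpace E] [FiniteDimensional ℝ E] {μ : Measure E}
    [μ.IsAddHaarMeasure] {b g : E → ℝ}
    (hb : LocallyIntegrable b μ) (hc : HasCompactSupport g) (hg : ContDiff ℝ (⊤ : ℕ∞) g) (x : E) :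
    ∃ L : E →L[ℝ] ℝ, HasFDerivAt (b ⋆[ContinuousLinearMap.lsmul ℝ ℝ, μ] g) L x ∧
      ∀ v, L v = (b ⋆[ContinuousLinearMap.lsmul ℝ ℝ, μ] fun y => fderiv ℝ g y v) x :=
  ⟨_, hc.hasFDerivAt_convolution_right _ hb (hg.of_le (by simp)) x, fun v =>
    convolution_precompR_apply _ hb (hc.fderiv ℝ) (hg.continuous_fderiv (by simp)) x v⟩

theorem fderiv_fderiv_comp_const_sub {E : Type*} [NormedAddCommGroup E] [NormedSpace ℝ E]
    (g : E → ℝ) (x t v w : E) :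
    fderiv ℝ (fun y => fderiv ℝ (fun z => g (x - z)) y v) t w =
      fderiv ℝ (fun y => fderiv ℝ g y v) (x - t) w := by
  have h (f : E → ℝ) (y u : E) : fderiv ℝ (fun z => f (x - z)) y u = -fderiv ℝ f (x - y) u := by
    have hneg : (fun z => f (x - z)) = (fun a => f (x + a)) ∘ ContinuousLinearEquiv.neg ℝ :=
      funext fun z => by simp [sub_eq_add_neg]
    rw [hneg, ContinuousLinearEquiv.comp_right_fderiv, fderiv_comp_add_left]
    simp [sub_eq_add_neg]
  simp_rw [h]
  rw [h (fun y => -fderiv ℝ g y v), fderiv_fun_neg]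
  simp

open scoped Convolution in
theorem pairing2_comp_const_sub (b g : (Fin 2 → ℝ) → ℝ) (x : Fin 2 → ℝ) (i j : Fin 2) :
    pairing2 b (fun t => g (x - t)) i j =
      (b ⋆[ContinuousLinearMap.lsmul ℝ ℝ, volume]
        fun y => fderiv ℝ (fun z => fderiv ℝ g z (Pi.single i 1)) y (Pi.single j 1)) x := by
  simp only [pairing2, fderiv_fderiv_comp_const_sub]
  rfl

/-- The span of `1`, `x₀`, `x₁`, `x₀² + x₁²`, as functions on a subset of the plane. -/
def radialQuadratics (S : Set (Fin 2 → ℝ)) : Submodule ℝ (S → ℝ) :=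
  Submodule.span ℝ (Set.range
    ![fun _ => 1, fun x => x.1 0, fun x => x.1 1, fun x => x.1 0 ^ 2 + x.1 1 ^ 2])

theorem mem_radialQuadratics {S : Set (Fin 2 → ℝ)} {f : S → ℝ} :
    f ∈ radialQuadratics S ↔ ∃ a p q r : ℝ, ∀ x : S,
      f x = a + p * x.1 0 + q * x.1 1 + r * (x.1 0 ^ 2 + x.1 1 ^ 2) := by
  rw [radialQuadratics, Submodule.mem_span_range_iff_exists_fun]
  constructor
  · rintro ⟨c, rfl⟩
    exact ⟨c 0, c 1, c 2, c 3, fun x => by simp [Fin.sum_univ_four]⟩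
  · rintro ⟨a, p, q, r, h⟩
    exact ⟨![a, p, q, r], funext fun x => by simp [Fin.sum_univ_four, h]⟩

theorem isClosed_radialQuadratics (S : Set (Fin 2 → ℝ)) :
    IsClosed (radialQuadratics S : Set (S → ℝ)) := by
  have : FiniteDimensional ℝ (radialQuadratics S) :=
    FiniteDimensional.span_of_finite ℝ (Set.finite_range _)
  exact (radialQuadratics S).closed_of_finiteDimensional

open scoped Convolution in
/-- Mollifying a weak solution of the system gives a quadratic polynomial. -/
theorem convolution_eq_quadratic {b : (Fin 2 → ℝ) → ℝ} (hb : LocallyIntegrable b volume)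
    (h1 : ∀ φ : (Fin 2 → ℝ) → ℝ, ContDiff ℝ (⊤ : ℕ∞) φ → HasCompactSupport φ →
      pairing2 b φ 0 1 = 0)
    (h2 : ∀ φ : (Fin 2 → ℝ) → ℝ, ContDiff ℝ (⊤ : ℕ∞) φ → HasCompactSupport φ →
      pairing2 b φ 0 0 - pairing2 b φ 1 1 = 0)
    {g : (Fin 2 → ℝ) → ℝ} (hg : ContDiff ℝ (⊤ : ℕ∞) g) (hc : HasCompactSupport g) :
    ∃ a p q r : ℝ, ∀ x : Fin 2 → ℝ, (b ⋆[ContinuousLinearMap.lsmul ℝ ℝ, volume] g) x =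
      a + p * x 0 + q * x 1 + r * (x 0 ^ 2 + x 1 ^ 2) := by
  set D : Fin 2 → ((Fin 2 → ℝ) → ℝ) → (Fin 2 → ℝ) → ℝ :=
    fun i f y => fderiv ℝ f y (Pi.single i 1)
  set C : ((Fin 2 → ℝ) → ℝ) → (Fin 2 → ℝ) → ℝ :=
    fun f => b ⋆[ContinuousLinearMap.lsmul ℝ ℝ, volume] f
  have smooth (i : Fin 2) : ContDiff ℝ (⊤ : ℕ∞) (D i g) :=
    (hg.fderiv_right (m := (⊤ : ℕ∞)) (by simp)).clm_apply contDiff_const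
  have supp (i : Fin 2) : HasCompactSupport (D i g) := hc.fderiv_apply ℝ _
  have deriv0 {f : (Fin 2 → ℝ) → ℝ} (hf : ContDiff ℝ (⊤ : ℕ∞) f) (hfc : HasCompactSupport f)
      (x y : ℝ) : HasDerivAt (fun s => C f ![s, y]) (C (D 0 f) ![x, y]) x := by
    obtain ⟨L, hL, hLv⟩ := hasFDerivAt_convolution_lsmul hb hfc hf ![x, y]
    have hline : HasDerivAt (fun s : ℝ => (![s, y] : Fin 2 → ℝ)) (Pi.single 0 1) x := by
      rw [hasDerivAt_pi]
      intro i
      fin_cases i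
      · simpa using hasDerivAt_id' x
      · simpa using hasDerivAt_const x y
    exact (hL.comp_hasDerivAt x hline).congr_deriv (hLv _)
  have deriv1 {f : (Fin 2 → ℝ) → ℝ} (hf : ContDiff ℝ (⊤ : ℕ∞) f) (hfc : HasCompactSupport f)
      (x y : ℝ) : HasDerivAt (fun s => C f ![x, s]) (C (D 1 f) ![x, y]) y := by
    obtain ⟨L, hL, hLv⟩ := hasFDerivAt_convolution_lsmul hb hfc hf ![x, y]
    have hline : HasDerivAt (fun s : ℝ => (![x, s] : Fin 2 → ℝ)) (Pi.single 1 1) y := by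
      rw [hasDerivAt_pi]
      intro i
      fin_cases i
      · simpa using hasDerivAt_const y x
      · simpa using hasDerivAt_id' y
    exact (hL.comp_hasDerivAt y hline).congr_deriv (hLv _)
  have reflSmooth (x : Fin 2 → ℝ) : ContDiff ℝ (⊤ : ℕ∞) fun t => g (x - t) :=
    hg.comp (contDiff_const.sub contDiff_id)
  have reflSupp (x : Fin 2 → ℝ) : HasCompactSupport fun t => g (x - t) :=
    hc.comp_homeomorph (Homeomorph.subLeft x)
  have mixed (x : Fin 2 → ℝ) : C (D 1 (D 0 g)) x = 0 := by
    have := h1 _ (reflSmooth x) (reflSupp x)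
    rwa [pairing2_comp_const_sub] at this
  have pure_eq (x : Fin 2 → ℝ) : C (D 1 (D 1 g)) x = C (D 0 (D 0 g)) x := by
    have := h2 _ (reflSmooth x) (reflSupp x)
    rw [pairing2_comp_const_sub, pairing2_comp_const_sub] at this
    exact (sub_eq_zero.mp this).symm
  have key := eq_quadratic_of_hasDerivAt
    (F := fun x y => C g ![x, y]) (P := fun x y => C (D 0 g) ![x, y])
    (Q := fun x y => C (D 1 g) ![x, y]) (R := fun x y => C (D 0 (D 0 g)) ![x, y])
    (deriv0 hg hc) (deriv1 hg hc) (deriv0 (smooth 0) (supp 0))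
    (fun x y => (deriv1 (smooth 0) (supp 0) x y).congr_deriv (mixed _))
    (fun x y => (deriv1 (smooth 1) (supp 1) x y).congr_deriv (pure_eq _))
  refine ⟨C g ![0, 0], C (D 0 g) ![0, 0], C (D 1 g) ![0, 0], C (D 0 (D 0 g)) ![0, 0] / 2,
    fun x => ?_⟩
  have hx : x = ![x 0, x 1] := by
    ext i
    fin_cases i <;> rfl
  have := key (x 0) (x 1)
  rw [← hx] at this
  exact this

/-- if `∂₁∂₂ b = 0` and `(∂₁² − ∂₂²) b = 0` distributionally, then `b` is a.e.
equal to a polynomial of total degree at most two. -/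
theorem stmt7 (b : (Fin 2 → ℝ) → ℝ) (hb : LocallyIntegrable b volume)
    (h1 : ∀ φ : (Fin 2 → ℝ) → ℝ, ContDiff ℝ (⊤ : ℕ∞) φ → HasCompactSupport φ →
      pairing2 b φ 0 1 = 0)
    (h2 : ∀ φ : (Fin 2 → ℝ) → ℝ, ContDiff ℝ (⊤ : ℕ∞) φ → HasCompactSupport φ →
      pairing2 b φ 0 0 - pairing2 b φ 1 1 = 0) :
    ∃ a₀ a₁ a₂ a₃ a₄ a₅ : ℝ,
      b =ᵐ[volume] fun x =>
        a₀ + a₁ * x 0 + a₂ * x 1 + a₃ * (x 0) ^ 2 + a₄ * (x 0 * x 1) + a₅ * (x 1) ^ 2 := by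
  let β : ℕ → ContDiffBump (0 : Fin 2 → ℝ) := fun n =>
    { rIn := 1 / (n + 1)
      rOut := 2 * (1 / (n + 1))
      rIn_pos := by positivity
      rIn_lt_rOut := by
        have : (0 : ℝ) < 1 / (n + 1) := by positivity
        linarith }
  have hβ : Filter.Tendsto (fun n => (β n).rOut) Filter.atTop (nhds 0) := by
    simpa [β] using (tendsto_one_div_add_atTop_nhds_zero_nat (𝕜 := ℝ)).const_mul 2
  have hlim := ContDiffBump.ae_convolution_tendsto_right_of_locallyIntegrable hβ
    (Filter.Eventually.of_forall fun n => (le_refl _ : (β n).rOut ≤ 2 * (β n).rIn)) hb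
  set S := {x | Filter.Tendsto (fun n => MeasureTheory.convolution ((β n).normed volume) b
    (ContinuousLinearMap.lsmul ℝ ℝ) volume x) Filter.atTop (nhds (b x))}
  have hmem : (fun x : S => b x) ∈ radialQuadratics S := by
    refine (isClosed_radialQuadratics S).mem_of_tendsto (tendsto_pi_nhds.mpr fun x => x.2)
      (Filter.Eventually.of_forall fun n => ?_)
    obtain ⟨a, p, q, r, h⟩ := convolution_eq_quadratic hb h1 h2
      ((β n).contDiff_normed (μ := volume))
      ((β n).hasCompactSupport_normed (μ := volume))
    refine mem_radialQuadratics.mpr ⟨a, p, q, r, fun x => ?_⟩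
    rw [← h, convolution_lsmul_swap, convolution_lsmul]
    simp only [smul_eq_mul, mul_comm]
  obtain ⟨a, p, q, r, h⟩ := mem_radialQuadratics.mp hmem
  refine ⟨a, p, q, r, 0, r, ?_⟩
  filter_upwards [hlim] with x hx
  rw [h ⟨x, hx⟩]
  ring
end
end

section
/- Let Ω ⊂ ℝ³ be open and simply connected, assume the ellipticity conditions η₂ < η₁ < η₃ and η₂ + η₃ > 2η₁, and let u: ℝ³ → ℝ³ be Lipschitz with e(u)(x) ∈ K₃ for a.e. x ∈ Ω. Then there exist nine functions f_i^j: ℝ → ℝ, i, j ∈ {1,2,3}, each depending on a single variable, such that for each i ∈ {1,2,3}, e(u)_{ii}(x) = f_i^1(x₁) + f_i^2(x₂) + f_i^3(x₃) for a.e. x = (x₁, x₂, x₃) ∈ Ω. -/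
open Matrix MeasureTheory

noncomputable section

open Set Filter Topology
open scoped ContDiff NNReal

/-- A Lipschitz map can be approximated uniformly by smooth maps with the same gradient bound in such
a way that affine constraints on the gradient valid near a point are inherited by the approximation. -/
lemma LipschitzWith.exists_smooth_approx {u : V3 → V3} {K : ℝ≥0} (hu : LipschitzWith K u)
    {δ : ℝ} (hδ : 0 < δ) :
    ∃ v : V3 → V3, ContDiff ℝ ∞ v ∧ (∀ x, dist (v x) (u x) ≤ K * δ) ∧ (∀ x, ‖fderiv ℝ v x‖ ≤ K) ∧
      ∀ (l : (V3 →L[ℝ] V3) →L[ℝ] ℝ) (c : ℝ) (x : V3),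
        (∀ᵐ y, y ∈ Metric.ball x δ → l (fderiv ℝ u y) = c) → l (fderiv ℝ v x) = c := by
  obtain ⟨φ, hφδ⟩ : ∃ φ : ContDiffBump (0 : V3), φ.rOut = δ :=
    ⟨⟨δ / 2, δ, by positivity, by linarith⟩, rfl⟩
  have hφs : ContDiff ℝ ∞ (φ.normed volume) := φ.contDiff_normed
  have hφi : Integrable (φ.normed volume) := φ.integrable_normed
  have hder : ∀ x, Integrable (fun t => φ.normed volume t • fderiv ℝ u (x - t)) ∧
      HasFDerivAt (fun y => ∫ t, φ.normed volume t • u (y - t))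
      (∫ t, φ.normed volume t • fderiv ℝ u (x - t)) x := by
    intro x
    have hcont : ∀ y, Continuous fun t => φ.normed volume t • u (y - t) := fun y =>
      hφs.continuous.smul (hu.continuous.comp (continuous_const.sub continuous_id))
    refine hasFDerivAt_integral_of_dominated_loc_of_lip (s := univ)
      (bound := fun t => φ.normed volume t * K) univ_mem
      (Eventually.of_forall fun y => (hcont y).aestronglyMeasurable) ?_ ?_ ?_ ?_ ?_
    · have hc : HasCompactSupport (φ.normed volume • fun t => u (x - t)) :=
        (φ.hasCompactSupport_normed (μ := volume)).smul_right
      exact (hcont x).integrable_of_hasCompactSupport hc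
    · have hm : Measurable fun t => fderiv ℝ u (x - t) :=
        (measurable_fderiv ℝ u).comp (measurable_const.sub measurable_id)
      exact hφs.continuous.aestronglyMeasurable.smul hm.aestronglyMeasurable
    · refine Eventually.of_forall fun t => LipschitzWith.lipschitzOnWith ?_
      refine LipschitzWith.of_dist_le_mul fun y z => ?_
      have h0 : 0 ≤ φ.normed volume t := φ.nonneg_normed t
      have h1 : dist (u (y - t)) (u (z - t)) ≤ K * dist y z := by
        simpa using hu.dist_le_mul (y - t) (z - t)
      have h2 : (0 : ℝ) ≤ φ.normed volume t * K := by positivity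
      rw [dist_smul₀, Real.coe_nnabs, abs_of_nonneg h2, Real.norm_of_nonneg h0, mul_assoc]
      gcongr
    · exact hφi.mul_const _
    · have := (Measure.measurePreserving_sub_left (volume : Measure V3)
        x).quasiMeasurePreserving.ae hu.ae_differentiableAt
      filter_upwards [this] with t ht
      have h3 : HasFDerivAt (fun y => u (y - t)) (fderiv ℝ u (x - t)) x :=
        (hasFDerivAt_comp_sub t).2 ht.hasFDerivAt
      exact h3.fun_const_smul _
  refine ⟨fun y => ∫ t, φ.normed volume t • u (y - t), ?_, ?_, ?_, ?_⟩
  · exact φ.hasCompactSupport_normed.contDiff_convolution_left (n := (⊤ : ℕ∞))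
      (ContinuousLinearMap.lsmul ℝ ℝ) hφs hu.continuous.locallyIntegrable
  · intro x
    refine φ.dist_normed_convolution_le hu.continuous.aestronglyMeasurable fun y hy => ?_
    refine (hu.dist_le_mul y x).trans ?_
    gcongr
    exact hφδ ▸ (Metric.mem_ball.1 hy).le
  · intro x
    rw [(hder x).2.fderiv]
    calc _ ≤ ∫ t, φ.normed volume t * (K : ℝ) := by
          refine norm_integral_le_of_norm_le (hφi.mul_const _) (Eventually.of_forall fun t => ?_)
          have h0 : 0 ≤ φ.normed volume t := φ.nonneg_normed t
          rw [norm_smul, Real.norm_of_nonneg h0]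
          gcongr
          exact norm_fderiv_le_of_lipschitz ℝ hu
      _ = K := by rw [integral_mul_const, φ.integral_normed, one_mul]
  · intro l c x hl
    rw [(hder x).2.fderiv, ← l.integral_comp_comm (hder x).1]
    have := (Measure.measurePreserving_sub_left (volume : Measure V3)
        x).quasiMeasurePreserving.ae hl
    calc _ = ∫ t, φ.normed volume t * c := by
          refine integral_congr_ae ?_
          filter_upwards [this] with t ht
          by_cases h : t ∈ Metric.ball (0 : V3) δ
          · rw [map_smul, ht (by simpa [Metric.mem_ball, dist_eq_norm] using h), smul_eq_mul]
          · have : φ.normed volume t = 0 := by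
              have := φ.support_normed_eq (μ := (volume : Measure V3))
              rw [hφδ] at this
              exact Function.notMem_support.1 (this ▸ h)
            simp [this]
      _ = c := by rw [integral_mul_const, φ.integral_normed, one_mul]

/-- The derivative of `f` in the fixed direction `e`. -/
def dirDeriv (e : V3) (f : V3 → ℝ) (x : V3) : ℝ := fderiv ℝ f x e

/-- The `i`-th standard basis vector. -/
def stdVec (i : Fin 3) : V3 := EuclideanSpace.single i 1

lemma stdVec_apply (i j : Fin 3) : stdVec i j = if j = i then 1 else 0 := by
  simp [stdVec]

lemma contDiff_dirDeriv {f : V3 → ℝ} (hf : ContDiff ℝ ∞ f) (e : V3) :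
    ContDiff ℝ ∞ (dirDeriv e f) :=
  (hf.fderiv_right (m := ∞) (by simp)).clm_apply contDiff_const

lemma dirDeriv_comm {f : V3 → ℝ} (hf : ContDiff ℝ ∞ f) (a b : V3) (x : V3) :
    dirDeriv a (dirDeriv b f) x = dirDeriv b (dirDeriv a f) x := by
  have h1 : DifferentiableAt ℝ (fderiv ℝ f) x :=
    ((hf.fderiv_right (m := ∞) (by simp)).differentiable (by simp)) x
  have h2 : ∀ e c : V3, dirDeriv c (dirDeriv e f) x = fderiv ℝ (fderiv ℝ f) x c e := by
    intro e c
    have := (h1.hasFDerivAt.clm_apply (hasFDerivAt_const e x)).fderiv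
    unfold dirDeriv
    rw [this]
    simp
  rw [h2, h2]
  exact (hf.contDiffAt.isSymmSndFDerivAt (by
    rw [minSmoothness_of_isRCLikeNormedField]
    exact WithTop.coe_le_coe.2 (le_top : (2 : ℕ∞) ≤ ⊤))) a b

lemma dirDeriv_congr {U : Set V3} (hU : IsOpen U) {f g : V3 → ℝ} (h : ∀ x ∈ U, f x = g x) (e : V3) :
    ∀ x ∈ U, dirDeriv e f x = dirDeriv e g x := by
  intro x hx
  have : f =ᶠ[𝓝 x] g := Filter.eventuallyEq_of_mem (hU.mem_nhds hx) h
  rw [dirDeriv, dirDeriv, this.fderiv_eq]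

lemma dirDeriv_add {f g : V3 → ℝ} (hf : ContDiff ℝ ∞ f) (hg : ContDiff ℝ ∞ g) (e x : V3) :
    dirDeriv e (fun y => f y + g y) x = dirDeriv e f x + dirDeriv e g x := by
  simp [dirDeriv, fderiv_fun_add (hf.differentiable (by simp) x) (hg.differentiable (by simp) x)]

lemma dirDeriv_sub {f g : V3 → ℝ} (hf : ContDiff ℝ ∞ f) (hg : ContDiff ℝ ∞ g) (e x : V3) :
    dirDeriv e (fun y => f y - g y) x = dirDeriv e f x - dirDeriv e g x := by
  simp [dirDeriv, fderiv_fun_sub (hf.differentiable (by simp) x) (hg.differentiable (by simp) x)]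

lemma dirDeriv_neg (f : V3 → ℝ) (e x : V3) :
    dirDeriv e (fun y => - f y) x = - dirDeriv e f x := by
  simp [dirDeriv]

lemma dirDeriv_const (c : ℝ) (e x : V3) : dirDeriv e (fun _ => c) x = 0 := by
  simp [dirDeriv]

lemma dirDeriv_vec_add (f : V3 → ℝ) (a b x : V3) :
    dirDeriv (a + b) f x = dirDeriv a f x + dirDeriv b f x := by
  simp [dirDeriv]

lemma dirDeriv_vec_sub (f : V3 → ℝ) (a b x : V3) :
    dirDeriv (a - b) f x = dirDeriv a f x - dirDeriv b f x := by
  simp [dirDeriv]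

lemma dirDeriv_comp_linear {g : ℝ → ℝ} (hg : Differentiable ℝ g) (l : V3 →L[ℝ] ℝ) (c : ℝ) (e x : V3) :
    dirDeriv e (fun y => g (l y - c)) x = deriv g (l x - c) * l e := by
  have h := ((hg (l x - c)).hasDerivAt.comp_hasFDerivAt x (l.hasFDerivAt.sub_const c)).fderiv
  unfold dirDeriv
  erw [h]
  simp

lemma dirDeriv_comp_add {f : V3 → ℝ} (a e x : V3) :
    dirDeriv e (fun y => f (y + a)) x = dirDeriv e f (x + a) := by
  unfold dirDeriv
  rw [fderiv_comp_add_right]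

lemma eq_of_dirDeriv_eq_zero {U : Set V3} (hU : IsOpen U) (hc : Convex ℝ U) {f : V3 → ℝ}
    (hf : ContDiff ℝ ∞ f) {e : V3} (h : ∀ x ∈ U, dirDeriv e f x = 0) {x : V3} (hx : x ∈ U) {s : ℝ}
    (hs : x + s • e ∈ U) : f (x + s • e) = f x := by
  set T : Set ℝ := (fun τ : ℝ => x + τ • e) ⁻¹' U with hT
  have hTo : IsOpen T := hU.preimage (by fun_prop)
  have hTc : Convex ℝ T := by
    intro a ha b hb α β hα hβ hαβ
    have := hc ha hb hα hβ hαβ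
    have h2 : α • (x + a • e) + β • (x + b • e) = x + (α • a + β • b) • e := by
      have : α = 1 - β := by linarith
      subst this
      module
    rw [h2] at this
    exact this
  have hd : ∀ τ, HasDerivAt (fun τ : ℝ => f (x + τ • e)) (dirDeriv e f (x + τ • e)) τ := by
    intro τ
    have h1 : HasDerivAt (fun τ : ℝ => x + τ • e) e τ := by
      simpa using ((hasDerivAt_id τ).smul_const e).const_add x
    exact ((hf.differentiable (by simp)) (x + τ • e)).hasFDerivAt.comp_hasDerivAt τ h1
  obtain ⟨C, hC⟩ := hTo.exists_is_const_of_deriv_eq_zero hTc.isPreconnected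
    (f := fun τ : ℝ => f (x + τ • e)) (fun τ _ => (hd τ).differentiableAt.differentiableWithinAt)
    (fun τ hτ => by simpa [(hd τ).deriv] using h _ hτ)
  have h1 := hC s hs
  have h0 := hC 0 (by simpa [hT] using hx)
  simp only [zero_smul, add_zero] at h0
  rw [h1, h0]

lemma Fin.eq_or_eq_or_eq_of_ne {i j k : Fin 3} (hij : i ≠ j) (hjk : j ≠ k) (hik : i ≠ k)
    (l : Fin 3) : l = i ∨ l = j ∨ l = k := by
  revert i j k l; decide

lemma Fin.sum_univ_three_of_ne {i j k : Fin 3} (hij : i ≠ j) (hjk : j ≠ k) (hik : i ≠ k)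
    (f : Fin 3 → ℝ) : ∑ a, f a = f i + f j + f k := by
  have : (Finset.univ : Finset (Fin 3)) = {i, j, k} := by
    revert i j k; decide
  rw [this, Finset.sum_insert (by simp [hij, hik]), Finset.sum_insert (by simp [hjk]),
    Finset.sum_singleton]
  ring

lemma mem_ball_iff_of_ne {i j k : Fin 3} (hij : i ≠ j) (hjk : j ≠ k) (hik : i ≠ k) {p x : V3}
    {r : ℝ} (hr : 0 < r) : x ∈ Metric.ball p r ↔
      (x i - p i) ^ 2 + (x j - p j) ^ 2 + (x k - p k) ^ 2 < r ^ 2 := by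
  rw [Metric.mem_ball, dist_eq_norm, EuclideanSpace.norm_eq, Real.sqrt_lt' hr,
    Fin.sum_univ_three_of_ne hij hjk hik]
  simp

/-- d'Alembert's formula, in the form of the parallelogram identity. -/
lemma wave_parallelogram {w : V3 → ℝ} (hw : ContDiff ℝ ∞ w) {p : V3} {r : ℝ} (hr : 0 < r)
    {i j k : Fin 3} (hij : i ≠ j) (hjk : j ≠ k) (hik : i ≠ k)
    (hk : ∀ x ∈ Metric.ball p r, dirDeriv (stdVec k) w x = 0)
    (hwave : ∀ x ∈ Metric.ball p r, dirDeriv (stdVec i) (dirDeriv (stdVec i) w) x =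
      dirDeriv (stdVec j) (dirDeriv (stdVec j) w) x)
    {x : V3} (hx : x ∈ Metric.ball p r) :
    w x = w (p + ((x i - p i + (x j - p j)) / 2) • (stdVec i + stdVec j)) +
      w (p + ((x i - p i - (x j - p j)) / 2) • (stdVec i - stdVec j)) - w p := by
  set U := Metric.ball p r with hUdef
  have hUo : IsOpen U := Metric.isOpen_ball
  have hUc : Convex ℝ U := convex_ball p r
  set s := (x i - p i + (x j - p j)) / 2 with hs
  set d := (x i - p i - (x j - p j)) / 2 with hd
  set a := stdVec i + stdVec j with ha
  set b := stdVec i - stdVec j with hb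
  have hx' := (mem_ball_iff_of_ne hij hjk hik hr).1 hx
  have hxi : x i - p i = s + d := by rw [hs, hd]; ring
  have hxj : x j - p j = s - d := by rw [hs, hd]; ring
  have hpi : p i + d + s - p i = s + d := by ring
  have hpj : p j + -d + s - p j = s - d := by ring
  rw [hxi, hxj] at hx'
  have hpU : p ∈ U := Metric.mem_ball_self hr
  have hxeq : x = (p + d • b + s • a) + (x k - p k) • stdVec k := by
    ext l
    rcases Fin.eq_or_eq_or_eq_of_ne hij hjk hik l with rfl | rfl | rfl <;>
    simp [ha, hb, stdVec_apply, hij, hik, hjk, hij.symm, hik.symm, hjk.symm, hs, hd] <;> ring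
  have hsU : p + s • a ∈ U := by
    rw [hUdef, mem_ball_iff_of_ne hij hjk hik hr]
    simp [ha, stdVec_apply, hij, hij.symm, hik.symm, hjk.symm]
    nlinarith [sq_nonneg d, sq_nonneg (x k - p k)]
  have hdU : p + d • b ∈ U := by
    rw [hUdef, mem_ball_iff_of_ne hij hjk hik hr]
    simp [hb, stdVec_apply, hij, hij.symm, hik.symm, hjk.symm]
    nlinarith [sq_nonneg s, sq_nonneg (x k - p k)]
  have hsdU : p + d • b + s • a ∈ U := by
    rw [hUdef, mem_ball_iff_of_ne hij hjk hik hr]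
    simp [ha, hb, stdVec_apply, hij, hij.symm, hik.symm, hjk.symm]
    rw [hpi, hpj]
    nlinarith [sq_nonneg (x k - p k)]
  have h1 : w x = w (p + d • b + s • a) := by
    conv_lhs => rw [hxeq]
    exact eq_of_dirDeriv_eq_zero hUo hUc hw hk hsdU (hxeq ▸ hx)
  set ψ := dirDeriv b w with hψ
  have hψs : ContDiff ℝ ∞ ψ := contDiff_dirDeriv hw b
  have hψa : ∀ y ∈ U, dirDeriv a ψ y = 0 := by
    intro y hy
    rw [hψ, dirDeriv_comm hw]
    have : dirDeriv a w = fun y => dirDeriv (stdVec i) w y + dirDeriv (stdVec j) w y := by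
      ext y; rw [ha, dirDeriv_vec_add]
    have hsi := contDiff_dirDeriv hw (stdVec i)
    have hsj := contDiff_dirDeriv hw (stdVec j)
    rw [this, dirDeriv_add hsi hsj, hb, dirDeriv_vec_sub, dirDeriv_vec_sub,
      hwave y hy, dirDeriv_comm hw (stdVec i) (stdVec j)]
    ring
  have hws : ContDiff ℝ ∞ fun y => w (y + s • a) := hw.comp (contDiff_id.add contDiff_const)
  have h2 := eq_of_dirDeriv_eq_zero (U := U ∩ (fun y => y + s • a) ⁻¹' U)
    (hUo.inter (hUo.preimage (by fun_prop)))
    (hUc.inter (by simpa [add_comm] using hUc.translate_preimage_right (s • a)))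
    (f := fun y => w (y + s • a) - w y) (hws.sub hw) (e := b) (x := p) (s := d)
    (by
      intro y hy
      rw [dirDeriv_sub hws hw, dirDeriv_comp_add, sub_eq_zero]
      exact eq_of_dirDeriv_eq_zero hUo hUc hψs hψa hy.1 hy.2) ⟨hpU, hsU⟩ ⟨hdU, hsdU⟩
  rw [h1]
  linarith

lemma apply_eq_of_dirDeriv_eq_zero {p : V3} {r : ℝ} {f : V3 → ℝ} (hf : ContDiff ℝ ∞ f)
    (h : ∀ l, ∀ x ∈ Metric.ball p r, dirDeriv (stdVec l) f x = 0) {x : V3}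
    (hx : x ∈ Metric.ball p r) : f x = f p := by
  refine Metric.isOpen_ball.is_const_of_fderiv_eq_zero (convex_ball p r).isPreconnected
    (hf.differentiable (by simp)).differentiableOn (fun y hy => ?_) hx
    (Metric.mem_ball_self (Metric.pos_of_mem_ball hx))
  refine ContinuousLinearMap.coe_injective ?_
  refine (EuclideanSpace.basisFun (Fin 3) ℝ).toBasis.ext fun l => ?_
  simpa [dirDeriv, stdVec] using h l y hy

lemma lipschitzWith_intervalIntegral {a : ℝ → ℝ} (ha : Continuous a) {M : ℝ≥0}
    (hM : ∀ s, |a s| ≤ M) : LipschitzWith M fun s => ∫ τ in (0 : ℝ)..s, a τ := by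
  refine lipschitzWith_of_nnnorm_deriv_le (𝕜 := ℝ)
    (fun s => (ha.integral_hasStrictDerivAt 0 s).hasDerivAt.differentiableAt) fun s => ?_
  rw [(ha.integral_hasStrictDerivAt 0 s).hasDerivAt.deriv]
  exact hM s

/-- Near `p`, the `i`-th component of `u` is an affine function of the `i`-th coordinate plus plane
waves in the directions `eᵢ ± eⱼ`, `j ≠ i`, with the profiles shared between the components. -/
structure IsWaveSum (u : V3 → V3) (p : V3) (r : ℝ) (M : ℝ≥0) (g : Fin 3 → ℝ)
    (α β : Fin 3 → Fin 3 → ℝ → ℝ) : Prop where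
  abs_le : ∀ i, |g i| ≤ M
  lipschitz_left : ∀ i j, LipschitzWith M (α i j)
  lipschitz_right : ∀ i j, LipschitzWith M (β i j)
  left_zero : ∀ i j, α i j 0 = 0
  right_zero : ∀ i j, β i j 0 = 0
  left_swap : ∀ i j s, α j i s = - α i j s
  right_swap : ∀ i j s, β j i s = β i j (-s)
  eq : ∀ i j k, i ≠ j → j ≠ k → i ≠ k → ∀ x ∈ Metric.ball p r,
    u x i = u p i + g i * (x i - p i) +
      (α i j (x i - p i + (x j - p j)) + β i j (x i - p i - (x j - p j))) +
      (α i k (x i - p i + (x k - p k)) + β i k (x i - p i - (x k - p k)))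

lemma exists_isWaveSum_of_contDiff {v : V3 → V3} (hv : ContDiff ℝ ∞ v) {K : ℝ≥0}
    (hK : ∀ x, ‖fderiv ℝ v x‖ ≤ K) {p : V3} {r : ℝ} (hr : 0 < r) {c : ℝ}
    (hoff : ∀ i j, i ≠ j → ∀ x ∈ Metric.ball p r,
      fderiv ℝ v x (stdVec i) j + fderiv ℝ v x (stdVec j) i = 0)
    (htr : ∀ x ∈ Metric.ball p r, ∑ i, fderiv ℝ v x (stdVec i) i = c) :
    ∃ g α β, IsWaveSum v p r (2 * K) g α β := by
  let P : Fin 3 → V3 →L[ℝ] ℝ := fun i => EuclideanSpace.proj i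
  have hP : ∀ i x, P i x = x i := fun i x => rfl
  set U := Metric.ball p r with hUdef
  have hU : IsOpen U := Metric.isOpen_ball
  have hpU : p ∈ U := Metric.mem_ball_self hr
  let f : Fin 3 → V3 → ℝ := fun i x => v x i
  have hf : ∀ i, ContDiff ℝ ∞ (f i) := fun i =>
    (P i).contDiff.comp hv
  have hDf : ∀ i e x, dirDeriv e (f i) x = fderiv ℝ v x e i := by
    intro i e x
    have := ((P i).hasFDerivAt.comp x
      (hv.differentiable (by simp) x).hasFDerivAt).fderiv
    have h2 : f i = (P i) ∘ v := rfl
    rw [dirDeriv, h2, this]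
    rfl
  have hDfb : ∀ i j x, |dirDeriv (stdVec j) (f i) x| ≤ K := by
    intro i j x
    rw [hDf]
    calc _ ≤ ‖fderiv ℝ v x (stdVec j)‖ := by
          simpa using PiLp.norm_apply_le (fderiv ℝ v x (stdVec j)) i
      _ ≤ ‖fderiv ℝ v x‖ * ‖stdVec j‖ := ContinuousLinearMap.le_opNorm _ _
      _ ≤ K := by simpa [stdVec] using hK x
  let D : Fin 3 → (V3 → ℝ) → V3 → ℝ := fun i h => dirDeriv (stdVec i) h
  have hDs : ∀ i {h : V3 → ℝ}, ContDiff ℝ ∞ h → ContDiff ℝ ∞ (D i h) := fun i h hh =>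
    contDiff_dirDeriv hh _
  have hcomm : ∀ i j {h : V3 → ℝ}, ContDiff ℝ ∞ h → D i (D j h) = D j (D i h) := fun i j h hh =>
    funext fun x => dirDeriv_comm hh _ _ x
  have hskew : ∀ i j, i ≠ j → ∀ x ∈ U, D i (f j) x = - D j (f i) x := by
    intro i j hij x hx
    have := hoff i j hij x hx
    simp only [D, hDf]; linarith
  have hskew1 : ∀ i j, i ≠ j → ∀ l, ∀ x ∈ U, D l (D i (f j)) x = - D l (D j (f i)) x := by
    intro i j hij l x hx
    refine (dirDeriv_congr hU (hskew i j hij) _ x hx).trans (dirDeriv_neg _ _ _)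
  have hskew2 : ∀ i j, i ≠ j → ∀ l m, ∀ x ∈ U,
      D m (D l (D i (f j))) x = - D m (D l (D j (f i))) x := by
    intro i j hij l m x hx
    refine (dirDeriv_congr hU (hskew1 i j hij l) _ x hx).trans (dirDeriv_neg _ _ _)
  have htr0 : ∀ i j k, i ≠ j → j ≠ k → i ≠ k → ∀ x ∈ U,
      D i (f i) x + D j (f j) x + D k (f k) x = c := by
    intro i j k hij hjk hik x hx
    rw [← htr x hx, Fin.sum_univ_three_of_ne hij hjk hik]
    simp only [D, hDf]
  have htr1 : ∀ i j k, i ≠ j → j ≠ k → i ≠ k → ∀ l, ∀ x ∈ U,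
      D l (D i (f i)) x + D l (D j (f j)) x + D l (D k (f k)) x = 0 := by
    intro i j k hij hjk hik l x hx
    have hi := hDs i (hf i)
    have hj := hDs j (hf j)
    have hk := hDs k (hf k)
    have := dirDeriv_congr hU (htr0 i j k hij hjk hik) (stdVec l) x hx
    rw [dirDeriv_const, dirDeriv_add (hi.add hj) hk, dirDeriv_add hi hj] at this
    exact this
  have htr2 : ∀ i j k, i ≠ j → j ≠ k → i ≠ k → ∀ l m, ∀ x ∈ U,
      D m (D l (D i (f i))) x + D m (D l (D j (f j))) x + D m (D l (D k (f k))) x = 0 := by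
    intro i j k hij hjk hik l m x hx
    have hi := hDs l (hDs i (hf i))
    have hj := hDs l (hDs j (hf j))
    have hk := hDs l (hDs k (hf k))
    have := dirDeriv_congr hU (htr1 i j k hij hjk hik l) (stdVec m) x hx
    rw [dirDeriv_const, dirDeriv_add (hi.add hj) hk, dirDeriv_add hi hj] at this
    exact this
  have hthird : ∀ i j k, i ≠ j → j ≠ k → i ≠ k → ∀ x ∈ U, D k (D j (f i)) x = 0 := by
    intro i j k hij hjk hik x hx
    have e1 := hskew1 i j hij k x hx
    have e2 := hskew1 j k hjk i x hx
    have e3 := hskew1 k i hik.symm j x hx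
    rw [hcomm k i (hf j)] at e1
    rw [hcomm i j (hf k)] at e2
    rw [hcomm j k (hf i)] at e3
    linarith
  have hthird1 : ∀ i j k, i ≠ j → j ≠ k → i ≠ k → ∀ l, ∀ x ∈ U, D l (D k (D j (f i))) x = 0 := by
    intro i j k hij hjk hik l x hx
    exact (dirDeriv_congr hU (hthird i j k hij hjk hik) _ x hx).trans (dirDeriv_const _ _ _)
  have hwave : ∀ i j k, i ≠ j → j ≠ k → i ≠ k → ∀ x ∈ U,
      D i (D i (D j (f i))) x = D j (D j (D j (f i))) x := by
    intro i j k hij hjk hik x hx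
    have e1 := hskew2 i j hij j j x hx
    have e2 := htr2 i j k hij hjk hik i j x hx
    have e3 := hthird1 k i j hik.symm hij hjk.symm k x hx
    rw [hcomm j i (hf j)] at e1
    rw [hcomm i j (hf i), hcomm i j (hDs i (hf i))]
    rw [hcomm k j (hDs i (hf k)), hcomm k i (hf k)] at e3
    linarith
  let w : Fin 3 → Fin 3 → V3 → ℝ := fun i j x => (D j (f i) x - D i (f j) x) / 2
  have hws : ∀ i j, ContDiff ℝ ∞ (w i j) := fun i j =>
    ((hDs j (hf i)).sub (hDs i (hf j))).div_const 2
  have hwswap : ∀ i j x, w j i x = - w i j x := by intro i j x; simp only [w]; ring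
  have hwb : ∀ i j x, |w i j x| ≤ K := by
    intro i j x
    have h1 := abs_le.1 (hDfb i j x)
    have h2 := abs_le.1 (hDfb j i x)
    simp only [w, D]
    rw [abs_le]; constructor <;> linarith [h1.1, h1.2, h2.1, h2.2]
  have hwU : ∀ i j, i ≠ j → ∀ x ∈ U, w i j x = D j (f i) x := by
    intro i j hij x hx
    simp only [w]; linarith [hskew i j hij x hx]
  have hwD : ∀ i j, i ≠ j → ∀ l, ∀ x ∈ U, D l (w i j) x = D l (D j (f i)) x := by
    intro i j hij l x hx
    exact dirDeriv_congr hU (hwU i j hij) _ x hx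
  have hwDD : ∀ i j, i ≠ j → ∀ l m, ∀ x ∈ U, D m (D l (w i j)) x = D m (D l (D j (f i))) x := by
    intro i j hij l m x hx
    exact dirDeriv_congr hU (hwD i j hij l) _ x hx
  let a : Fin 3 → Fin 3 → ℝ → ℝ := fun i j s =>
    w i j (p + (s / 2) • (stdVec i + stdVec j)) - w i j p / 2
  let b : Fin 3 → Fin 3 → ℝ → ℝ := fun i j s =>
    - w i j (p + (s / 2) • (stdVec i - stdVec j)) + w i j p / 2
  have has : ∀ i j, ContDiff ℝ ∞ (a i j) := fun i j =>
    ((hws i j).comp (contDiff_const.add ((contDiff_id.div_const 2).smul contDiff_const))).sub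
      contDiff_const
  have hbs : ∀ i j, ContDiff ℝ ∞ (b i j) := fun i j =>
    ((hws i j).comp (contDiff_const.add
      ((contDiff_id.div_const 2).smul contDiff_const))).neg.add contDiff_const
  have hab : ∀ i j s, |a i j s| ≤ (2 * K : ℝ≥0) := by
    intro i j s
    have h1 := abs_le.1 (hwb i j (p + (s / 2) • (stdVec i + stdVec j)))
    have h2 := abs_le.1 (hwb i j p)
    simp only [a, NNReal.coe_mul, NNReal.coe_ofNat]
    rw [abs_le]; constructor <;> linarith [h1.1, h1.2, h2.1, h2.2]
  have hbb : ∀ i j s, |b i j s| ≤ (2 * K : ℝ≥0) := by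
    intro i j s
    have h1 := abs_le.1 (hwb i j (p + (s / 2) • (stdVec i - stdVec j)))
    have h2 := abs_le.1 (hwb i j p)
    simp only [b, NNReal.coe_mul, NNReal.coe_ofNat]
    rw [abs_le]; constructor <;> linarith [h1.1, h1.2, h2.1, h2.2]
  have haswap : ∀ i j s, a j i s = - a i j s := by
    intro i j s
    simp only [a]
    rw [hwswap, hwswap i j p, add_comm (stdVec j)]; ring
  have hbswap : ∀ i j s, b j i s = - b i j (-s) := by
    intro i j s
    simp only [b]
    have : (s / 2) • (stdVec j - stdVec i) = (-s / 2) • (stdVec i - stdVec j) := by module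
    rw [hwswap, hwswap i j p, this]; ring
  let A : Fin 3 → Fin 3 → V3 → ℝ := fun i j x => a i j ((P i + P j) x - (P i + P j) p)
  let B : Fin 3 → Fin 3 → V3 → ℝ := fun i j x => b i j ((P i - P j) x - (P i - P j) p)
  have hAs : ∀ i j, ContDiff ℝ ∞ (A i j) := fun i j =>
    (has i j).comp ((P i + P j).contDiff.sub contDiff_const)
  have hBs : ∀ i j, ContDiff ℝ ∞ (B i j) := fun i j =>
    (hbs i j).comp ((P i - P j).contDiff.sub contDiff_const)
  have hDA : ∀ i j l x, D l (A i j) x =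
      deriv (a i j) ((P i + P j) x - (P i + P j) p) * (P i + P j) (stdVec l) := fun i j l x =>
    dirDeriv_comp_linear ((has i j).differentiable (by simp)) _ _ _ _
  have hDB : ∀ i j l x, D l (B i j) x =
      deriv (b i j) ((P i - P j) x - (P i - P j) p) * (P i - P j) (stdVec l) := fun i j l x =>
    dirDeriv_comp_linear ((hbs i j).differentiable (by simp)) _ _ _ _
  have hDAt : ∀ i j k, i ≠ j → j ≠ k → i ≠ k → ∀ x, D k (A i j) x = 0 := by
    intro i j k hij hjk hik x
    simp [hDA, hP, stdVec_apply, hjk, hik]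
  have hDBt : ∀ i j k, i ≠ j → j ≠ k → i ≠ k → ∀ x, D k (B i j) x = 0 := by
    intro i j k hij hjk hik x
    simp [hDB, hP, stdVec_apply, hjk, hik]
  have hDAs : ∀ i j, i ≠ j → ∀ x, D i (A i j) x = D j (A i j) x := by
    intro i j hij x
    simp [hDA, hP, stdVec_apply, hij, hij.symm]
  have hDBs : ∀ i j, i ≠ j → ∀ x, D i (B i j) x = - D j (B i j) x := by
    intro i j hij x
    simp [hDB, hP, stdVec_apply, hij, hij.symm]
  have hrep : ∀ i j k, i ≠ j → j ≠ k → i ≠ k → ∀ x ∈ U, D j (f i) x = A i j x - B i j x := by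
    intro i j k hij hjk hik x hx
    rw [← hwU i j hij x hx, wave_parallelogram (hws i j) hr hij hjk hik
      (fun y hy => (hwD i j hij k y hy).trans (hthird i j k hij hjk hik y hy))
      (fun y hy => (hwDD i j hij i i y hy).trans
        ((hwave i j k hij hjk hik y hy).trans (hwDD i j hij j j y hy).symm)) hx]
    have e1 : (P i + P j) x - (P i + P j) p = x i - p i + (x j - p j) := by simp [hP]; ring
    have e2 : (P i - P j) x - (P i - P j) p = x i - p i - (x j - p j) := by simp [hP]; ring
    simp only [A, B, a, b, e1, e2]
    ring
  have hrep1 : ∀ i j k, i ≠ j → j ≠ k → i ≠ k → ∀ l, ∀ x ∈ U,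
      D l (D j (f i)) x = D l (A i j) x - D l (B i j) x := by
    intro i j k hij hjk hik l x hx
    exact (dirDeriv_congr hU (hrep i j k hij hjk hik) _ x hx).trans
      (dirDeriv_sub (hAs i j) (hBs i j) _ _)
  have hdiag : ∀ i j k, i ≠ j → j ≠ k → i ≠ k → ∀ x ∈ U,
      D i (f i) x = D i (f i) p + (A i j x + B i j x) + (A i k x + B i k x) := by
    intro i j k hij hjk hik x hx
    have sD := hDs i (hf i)
    have hZ : ∀ l y, D l (fun y => D i (f i) y - (A i j y + B i j y + (A i k y + B i k y))) y =
        D l (D i (f i)) y - (D l (A i j) y + D l (B i j) y + (D l (A i k) y + D l (B i k) y)) := by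
      intro l y
      have s1 := (hAs i j).add (hBs i j)
      have s2 := (hAs i k).add (hBs i k)
      exact (dirDeriv_sub sD (s1.add s2) _ _).trans (by
        rw [dirDeriv_add s1 s2, dirDeriv_add (hAs i j) (hBs i j), dirDeriv_add (hAs i k) (hBs i k)])
    have key : ∀ j k, i ≠ j → j ≠ k → i ≠ k → ∀ y ∈ U,
        D j (D i (f i)) y = D j (A i j) y + D j (B i j) y := by
      intro j k hij hjk hik y hy
      rw [hcomm j i (hf i), hrep1 i j k hij hjk hik i y hy, hDAs i j hij, hDBs i j hij]
      ring
    have key2 : ∀ j k, i ≠ j → j ≠ k → i ≠ k → ∀ y ∈ U,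
        D i (D j (f j)) y = - (D i (A i j) y + D i (B i j) y) := by
      intro j k hij hjk hik y hy
      rw [hcomm i j (hf j), hskew1 i j hij j y hy, hrep1 i j k hij hjk hik j y hy, hDAs i j hij,
        hDBs i j hij]
      ring
    have hz := apply_eq_of_dirDeriv_eq_zero
      (f := fun y => D i (f i) y - (A i j y + B i j y + (A i k y + B i k y)))
      (sD.sub (((hAs i j).add (hBs i j)).add ((hAs i k).add (hBs i k)))) (p := p) (r := r) (by
        intro l y hy
        refine (hZ l y).trans ?_
        rcases Fin.eq_or_eq_or_eq_of_ne hij hjk hik l with rfl | rfl | rfl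
        · have e1 := htr1 l j k hij hjk hik l y hy
          have e2 := key2 j k hij hjk hik y hy
          have e3 := key2 k j hik hjk.symm hij y hy
          linarith
        · rw [key l k hij hjk hik y hy, hDAt i k l hik hjk.symm hij, hDBt i k l hik hjk.symm hij]
          ring
        · rw [key l j hik hjk.symm hij y hy, hDAt i j l hij hjk hik, hDBt i j l hij hjk hik]
          ring) hx
    have hp0 : ∀ j, A i j p + B i j p = 0 := by
      intro j
      simp only [A, B, a, b, sub_self, zero_div, zero_smul, add_zero]
      ring
    have := hp0 j
    have := hp0 k
    linarith
  let α : Fin 3 → Fin 3 → ℝ → ℝ := fun i j s => ∫ τ in (0 : ℝ)..s, a i j τ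
  let β : Fin 3 → Fin 3 → ℝ → ℝ := fun i j s => ∫ τ in (0 : ℝ)..s, b i j τ
  have hαs : ∀ i j, ContDiff ℝ ∞ (α i j) := by
    intro i j
    have h : ∀ s, HasDerivAt (α i j) (a i j s) s := fun s =>
      ((has i j).continuous.integral_hasStrictDerivAt 0 s).hasDerivAt
    rw [contDiff_infty_iff_deriv]
    refine ⟨fun s => (h s).differentiableAt, ?_⟩
    rw [funext fun s => (h s).deriv]
    exact has i j
  have hβs : ∀ i j, ContDiff ℝ ∞ (β i j) := by
    intro i j
    have h : ∀ s, HasDerivAt (β i j) (b i j s) s := fun s =>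
      ((hbs i j).continuous.integral_hasStrictDerivAt 0 s).hasDerivAt
    rw [contDiff_infty_iff_deriv]
    refine ⟨fun s => (h s).differentiableAt, ?_⟩
    rw [funext fun s => (h s).deriv]
    exact hbs i j
  have hdα : ∀ i j, deriv (α i j) = a i j := fun i j => funext fun s =>
    ((has i j).continuous.integral_hasStrictDerivAt 0 s).hasDerivAt.deriv
  have hdβ : ∀ i j, deriv (β i j) = b i j := fun i j => funext fun s =>
    ((hbs i j).continuous.integral_hasStrictDerivAt 0 s).hasDerivAt.deriv
  refine ⟨fun i => D i (f i) p, α, β, fun i => ?_,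
    fun i j => lipschitzWith_intervalIntegral (has i j).continuous (hab i j),
    fun i j => lipschitzWith_intervalIntegral (hbs i j).continuous (hbb i j),
    fun i j => intervalIntegral.integral_same, fun i j => intervalIntegral.integral_same,
    fun i j s => ?_, fun i j s => ?_, ?_⟩
  · refine (hDfb i i p).trans ?_
    simp only [NNReal.coe_mul, NNReal.coe_ofNat]
    linarith [K.coe_nonneg]
  · simp only [α, haswap i j, intervalIntegral.integral_neg]
  · simp only [β, hbswap i j, intervalIntegral.integral_neg, intervalIntegral.integral_comp_neg,
      neg_zero]
    rw [intervalIntegral.integral_symm]; simp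
  · intro i j k hij hjk hik x hx
    let Aα : Fin 3 → V3 → ℝ := fun j x => α i j ((P i + P j) x - (P i + P j) p)
    let Bβ : Fin 3 → V3 → ℝ := fun j x => β i j ((P i - P j) x - (P i - P j) p)
    let L : V3 → ℝ := fun x => D i (f i) p * (P i x - P i p)
    have sA : ∀ j, ContDiff ℝ ∞ (Aα j) := fun j =>
      (hαs i j).comp ((P i + P j).contDiff.sub contDiff_const)
    have sB : ∀ j, ContDiff ℝ ∞ (Bβ j) := fun j =>
      (hβs i j).comp ((P i - P j).contDiff.sub contDiff_const)
    have sL : ContDiff ℝ ∞ L := contDiff_const.mul ((P i).contDiff.sub contDiff_const)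
    have dA : ∀ j l x, D l (Aα j) x = A i j x * (P i + P j) (stdVec l) := fun j l x =>
      (dirDeriv_comp_linear ((hαs i j).differentiable (by simp)) _ _ _ _).trans (by rw [hdα])
    have dB : ∀ j l x, D l (Bβ j) x = B i j x * (P i - P j) (stdVec l) := fun j l x =>
      (dirDeriv_comp_linear ((hβs i j).differentiable (by simp)) _ _ _ _).trans (by rw [hdβ])
    have dL : ∀ l x, D l L x = D i (f i) p * P i (stdVec l) := fun l x =>
      (dirDeriv_comp_linear (g := fun s => D i (f i) p * s) (by fun_prop) _ _ _ _).trans (by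
        congr 1
        simp)
    have s1 := (sA j).add (sB j)
    have s2 := (sA k).add (sB k)
    have hz := apply_eq_of_dirDeriv_eq_zero (p := p) (r := r)
      (f := fun y => f i y - (L y + (Aα j y + Bβ j y) + (Aα k y + Bβ k y)))
      ((hf i).sub ((sL.add s1).add s2)) (by
        intro l y hy
        rw [dirDeriv_sub (hf i) ((sL.add s1).add s2), dirDeriv_add (sL.add s1) s2,
          dirDeriv_add sL s1, dirDeriv_add (sA j) (sB j), dirDeriv_add (sA k) (sB k)]
        change D l (f i) y - (D l L y + (D l (Aα j) y + D l (Bβ j) y) +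
          (D l (Aα k) y + D l (Bβ k) y)) = 0
        rw [dL, dA, dA, dB, dB]
        rcases Fin.eq_or_eq_or_eq_of_ne hij hjk hik l with rfl | rfl | rfl
        · rw [hdiag l j k hij hjk hik y hy]
          simp [hP, stdVec_apply, hij.symm, hik.symm]
        · rw [hrep i l k hij hjk hik y hy]
          simp [hP, stdVec_apply, hij, hjk.symm]
          ring
        · rw [hrep i l j hik hjk.symm hij y hy]
          simp [hP, stdVec_apply, hik, hjk]
          ring) hx
    have e1 : ∀ j, (P i + P j) x - (P i + P j) p = x i - p i + (x j - p j) := by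
      intro j; simp [hP]; ring
    have e2 : ∀ j, (P i - P j) x - (P i - P j) p = x i - p i - (x j - p j) := by
      intro j; simp [hP]; ring
    have h0 : ∀ j, α i j 0 = 0 := fun j => intervalIntegral.integral_same
    have h0' : ∀ j, β i j 0 = 0 := fun j => intervalIntegral.integral_same
    simp only [Aα, Bβ, L, e1, e2, sub_self, h0, h0', hP, mul_zero, f] at hz
    linarith

lemma Ultrafilter.exists_tendsto_of_abs_le {ι : Type*} (F : Ultrafilter ι) {x : ι → ℝ} {C : ℝ}
    (h : ∀ n, |x n| ≤ C) : ∃ y, Tendsto x F (𝓝 y) := by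
  obtain ⟨y, -, hy⟩ := (isCompact_Icc (a := -C) (b := C)).ultrafilter_le_nhds (F.map x)
    (tendsto_principal.2 (Eventually.of_forall fun n => abs_le.1 (h n)))
  exact ⟨y, hy⟩

lemma Ultrafilter.lipschitzWith_of_tendsto {ι : Type*} (F : Ultrafilter ι) {f : ι → ℝ → ℝ}
    {M : ℝ≥0} (hf : ∀ n, LipschitzWith M (f n)) {f' : ℝ → ℝ}
    (h : ∀ s, Tendsto (fun n => f n s) F (𝓝 (f' s))) : LipschitzWith M f' :=
  LipschitzWith.of_dist_le_mul fun s t => le_of_tendsto ((h s).dist (h t))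
    (Eventually.of_forall fun n => (hf n).dist_le_mul s t)

lemma LipschitzWith.abs_apply_le {f : ℝ → ℝ} {M : ℝ≥0} (hf : LipschitzWith M f) (h0 : f 0 = 0)
    (s : ℝ) : |f s| ≤ M * |s| := by
  simpa [Real.dist_eq, h0] using hf.dist_le_mul s 0

lemma exists_isWaveSum {u : V3 → V3} {K : ℝ≥0} (hu : LipschitzWith K u) {p : V3} {r : ℝ}
    (hr : 0 < r) {c : ℝ}
    (hoff : ∀ i j, i ≠ j → ∀ᵐ x, x ∈ Metric.ball p (2 * r) →
      fderiv ℝ u x (stdVec i) j + fderiv ℝ u x (stdVec j) i = 0)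
    (htr : ∀ᵐ x, x ∈ Metric.ball p (2 * r) → ∑ i, fderiv ℝ u x (stdVec i) i = c) :
    ∃ g α β, IsWaveSum u p r (2 * K) g α β := by
  let δ : ℕ → ℝ := fun n => r / (n + 1)
  have hδ : ∀ n, 0 < δ n := fun n => by positivity
  have hδr : ∀ n, δ n ≤ r := fun n => div_le_self hr.le (by simp)
  have hδ0 : Tendsto δ atTop (𝓝 0) := by
    have := (tendsto_one_div_add_atTop_nhds_zero_nat (𝕜 := ℝ)).const_mul r
    simpa [δ, div_eq_mul_inv] using this
  have hsub : ∀ n, ∀ x ∈ Metric.ball p r, Metric.ball x (δ n) ⊆ Metric.ball p (2 * r) := by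
    intro n x hx
    refine Metric.ball_subset_ball' ?_
    have := Metric.mem_ball.1 hx
    linarith [hδr n]
  let ev : V3 → Fin 3 → (V3 →L[ℝ] V3) →L[ℝ] ℝ := fun e i =>
    (EuclideanSpace.proj i : V3 →L[ℝ] ℝ).comp (ContinuousLinearMap.apply ℝ V3 e)
  have hev : ∀ e i T, ev e i T = T e i := fun _ _ _ => rfl
  choose v hv hvd hvK hvl using fun n => hu.exists_smooth_approx (hδ n)
  have hw : ∀ n, ∃ g α β, IsWaveSum (v n) p r (2 * K) g α β := by
    intro n
    refine exists_isWaveSum_of_contDiff (hv n) (hvK n) hr (c := c) (fun i j hij x hx => ?_)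
      fun x hx => ?_
    · exact hvl n (ev (stdVec i) j + ev (stdVec j) i) 0 x (by
        filter_upwards [hoff i j hij] with y hy hyx using hy (hsub n x hx hyx))
    · have := hvl n (∑ i, ev (stdVec i) i) c x (by
        filter_upwards [htr] with y hy hyx
        simpa [hev] using hy (hsub n x hx hyx))
      simpa [hev] using this
  choose g α β h using hw
  let F : Ultrafilter ℕ := hyperfilter ℕ
  have hF : (F : Filter ℕ) ≤ atTop := Nat.hyperfilter_le_atTop
  choose g' hg' using fun i => F.exists_tendsto_of_abs_le fun n => (h n).abs_le i
  choose α' hα' using fun i j s => F.exists_tendsto_of_abs_le fun n =>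
    ((h n).lipschitz_left i j).abs_apply_le ((h n).left_zero i j) s
  choose β' hβ' using fun i j s => F.exists_tendsto_of_abs_le fun n =>
    ((h n).lipschitz_right i j).abs_apply_le ((h n).right_zero i j) s
  have hvu : ∀ x, Tendsto (fun n => v n x) F (𝓝 (u x)) := by
    intro x
    refine Tendsto.mono_left ?_ hF
    rw [tendsto_iff_dist_tendsto_zero]
    refine squeeze_zero (fun _ => dist_nonneg) (fun n => hvd n x) ?_
    simpa using hδ0.const_mul (K : ℝ)
  have hvui : ∀ x i, Tendsto (fun n => v n x i) F (𝓝 (u x i)) := fun x i =>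
    ((EuclideanSpace.proj i : V3 →L[ℝ] ℝ).continuous.tendsto _).comp (hvu x)
  refine ⟨g', α', β', fun i => ?_, fun i j => F.lipschitzWith_of_tendsto
    (fun n => (h n).lipschitz_left i j) (hα' i j), fun i j => F.lipschitzWith_of_tendsto
    (fun n => (h n).lipschitz_right i j) (hβ' i j), fun i j => ?_, fun i j => ?_, fun i j s => ?_,
    fun i j s => ?_, fun i j k hij hjk hik x hx => ?_⟩
  · exact le_of_tendsto (hg' i).abs (Eventually.of_forall fun n => (h n).abs_le i)
  · exact tendsto_nhds_unique (hα' i j 0) (by simp [(h _).left_zero])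
  · exact tendsto_nhds_unique (hβ' i j 0) (by simp [(h _).right_zero])
  · exact tendsto_nhds_unique (hα' j i s) (by simpa [(h _).left_swap i j] using (hα' i j s).neg)
  · exact tendsto_nhds_unique (hβ' j i s) (by simpa [(h _).right_swap i j] using hβ' i j (-s))
  · refine tendsto_nhds_unique (hvui x i) ?_
    simp only [fun n => (h n).eq i j k hij hjk hik x hx]
    exact ((((hvui p i).add ((hg' i).mul_const _)).add ((hα' i j _).add (hβ' i j _))).add
      ((hα' i k _).add (hβ' i k _)))

lemma LipschitzWith.ae_differentiableAt_comp_linear {φ : ℝ → ℝ} {M : ℝ≥0} (hφ : LipschitzWith M φ)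
    (l : V3 →ₗ[ℝ] ℝ) (hl : Function.Surjective l) (c : ℝ) :
    ∀ᵐ x, DifferentiableAt ℝ φ (l x - c) := by
  have hφ' : LipschitzWith M fun s => φ (s - c) := by
    simpa [Function.comp_def] using hφ.comp ((LipschitzWith.id (α := ℝ)).sub (LipschitzWith.const c))
  have h := (MeasureTheory.ae_comp_linearMap_mem_iff l volume volume hl
    (measurableSet_of_differentiableAt ℝ fun s => φ (s - c))).2 hφ'.ae_differentiableAt
  filter_upwards [h] with x hx
  simpa using (differentiableAt_comp_sub_const).1 hx

lemma IsWaveSum.ae_fderiv_apply_eq {u : V3 → V3} {K : ℝ≥0} (hu : LipschitzWith K u) {p : V3} {r : ℝ}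
    {M : ℝ≥0} {g : Fin 3 → ℝ} {α β : Fin 3 → Fin 3 → ℝ → ℝ} (h : IsWaveSum u p r M g α β)
    {i j k : Fin 3} (hij : i ≠ j) (hjk : j ≠ k) (hik : i ≠ k) :
    ∀ᵐ x, x ∈ Metric.ball p r → fderiv ℝ u x (stdVec i) i = g i +
      (deriv (α i j) (x i - p i + (x j - p j)) + deriv (β i j) (x i - p i - (x j - p j))) +
      (deriv (α i k) (x i - p i + (x k - p k)) + deriv (β i k) (x i - p i - (x k - p k))) := by
  let P : Fin 3 → V3 →ₗ[ℝ] ℝ := fun i => (EuclideanSpace.proj i : V3 →L[ℝ] ℝ)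
  have hP : ∀ i x, P i x = x i := fun i x => rfl
  have hadd : ∀ j, i ≠ j → Function.Surjective (P i + P j) := fun j hj y =>
    ⟨y • stdVec i, by simp [hP, stdVec_apply, hj.symm]⟩
  have hsub : ∀ j, i ≠ j → Function.Surjective (P i - P j) := fun j hj y =>
    ⟨y • stdVec i, by simp [hP, stdVec_apply, hj.symm]⟩
  have eadd : ∀ j x, (P i + P j) x - (p i + p j) = x i - p i + (x j - p j) := fun j x => by
    simp only [LinearMap.add_apply, hP]; ring
  have esub : ∀ j x, (P i - P j) x - (p i - p j) = x i - p i - (x j - p j) := fun j x => by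
    simp only [LinearMap.sub_apply, hP]; ring
  filter_upwards [hu.ae_differentiableAt,
    (h.lipschitz_left i j).ae_differentiableAt_comp_linear _ (hadd j hij) (p i + p j),
    (h.lipschitz_right i j).ae_differentiableAt_comp_linear _ (hsub j hij) (p i - p j),
    (h.lipschitz_left i k).ae_differentiableAt_comp_linear _ (hadd k hik) (p i + p k),
    (h.lipschitz_right i k).ae_differentiableAt_comp_linear _ (hsub k hik) (p i - p k)]
    with x hx h1 h2 h3 h4 hxb
  rw [eadd] at h1 h3
  rw [esub] at h2 h4
  have hline : HasDerivAt (fun τ : ℝ => x + τ • stdVec i) (stdVec i) 0 := by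
    simpa using ((hasDerivAt_id (0 : ℝ)).smul_const (stdVec i)).const_add x
  have hu' : HasDerivAt (fun τ : ℝ => u (x + τ • stdVec i) i) (fderiv ℝ u x (stdVec i) i) 0 := by
    have hx' : HasFDerivAt u (fderiv ℝ u x) (x + (0 : ℝ) • stdVec i) := by
      simpa using hx.hasFDerivAt
    exact (EuclideanSpace.proj i : V3 →L[ℝ] ℝ).hasFDerivAt.comp_hasDerivAt 0
      (hx'.comp_hasDerivAt 0 hline)
  have hsh : ∀ {φ : ℝ → ℝ} {s : ℝ}, DifferentiableAt ℝ φ s →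
      HasDerivAt (fun τ => φ (s + τ)) (deriv φ s) 0 := fun {φ s} hφ => by
    have : HasDerivAt φ (deriv φ s) (s + 0) := by simpa using hφ.hasDerivAt
    exact this.comp_const_add s 0
  have hid : HasDerivAt (fun τ => u p i + g i * (x i - p i + τ)) (g i) 0 := by
    simpa using (((hasDerivAt_id (0 : ℝ)).const_add (x i - p i)).const_mul (g i)).const_add (u p i)
  have hR := (hid.add ((hsh h1).add (hsh h2))).add ((hsh h3).add (hsh h4))
  refine hu'.unique (hR.congr_of_eventuallyEq ?_)
  have hmem : ∀ᶠ τ : ℝ in 𝓝 0, x + τ • stdVec i ∈ Metric.ball p r :=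
    hline.continuousAt.eventually_mem (by
      simpa only [zero_smul, add_zero] using Metric.isOpen_ball.mem_nhds hxb)
  filter_upwards [hmem] with τ hτ
  rw [h.eq i j k hij hjk hik _ hτ]
  simp only [PiLp.add_apply, PiLp.smul_apply, stdVec_apply, if_true, if_neg hij.symm,
    if_neg hik.symm, smul_eq_mul, mul_one, mul_zero, add_zero, Pi.add_apply]
  congr 1
  · congr 1
    · ring
    · congr 2 <;> ring
  · congr 2 <;> ring

/-- If `f y + h z` takes a.e. at most three values, not in arithmetic progression, then `f` or `h`
is a.e. constant. -/
lemma ae_eq_const_or_ae_eq_const_of_add_mem {μ : Measure ℝ} {a b c : ℝ} (hab : a < b) (hbc : b < c)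
    (hne : a + c ≠ 2 * b) {f h : ℝ → ℝ} (hfh : ∀ᵐ y ∂μ, ∀ᵐ z ∂μ, f y + h z ∈ ({a, b, c} : Set ℝ)) :
    (∃ k, ∀ᵐ y ∂μ, f y = k) ∨ ∃ k, ∀ᵐ z ∂μ, h z = k := by
  rcases eq_or_ne μ 0 with rfl | hμ
  · simp
  have := ae_neBot.2 hμ
  obtain ⟨y₀, hy₀⟩ := hfh.exists
  by_contra! hcon
  obtain ⟨hf, hh⟩ := hcon
  refine hf (f y₀) ?_
  filter_upwards [hfh] with y hy
  by_contra hne'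
  obtain ⟨z₀, hz₀, hz₀'⟩ := (hy₀.and hy).exists
  refine hh (h z₀) ?_
  filter_upwards [hy₀, hy] with z hz hz'
  by_contra hnz
  simp only [mem_insert_iff, mem_singleton_iff] at hz hz' hz₀ hz₀'
  rcases lt_or_gt_of_ne hne' with h1 | h1 <;> rcases lt_or_gt_of_ne hnz with h2 | h2 <;> grind

/-- On the interval of radius `R` about `x`, the function `t ↦ α (x + t) - β (x - t)` is affine. -/
def IsAffineDiff (R : ℝ) (α β : ℝ → ℝ) (x : ℝ) : Prop :=
  ∀ t ∈ Icc (-R) R, α (x + t) - β (x - t) =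
    α x - β x + t * ((α (x + R) - β (x - R) - (α x - β x)) / R)

lemma isClosed_setOf_isAffineDiff {R : ℝ} {α β : ℝ → ℝ} (hα : Continuous α) (hβ : Continuous β) :
    IsClosed {x | IsAffineDiff R α β x} := by
  simp only [IsAffineDiff, ofPred_forall]
  exact isClosed_iInter fun t => isClosed_iInter fun _ => isClosed_eq (by fun_prop) (by fun_prop)

lemma isAffineDiff_of_ae_deriv_eq {R : ℝ} (hR : 0 < R) {α β : ℝ → ℝ} {M : ℝ≥0}
    (hα : LipschitzWith M α) (hβ : LipschitzWith M β) {x k : ℝ}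
    (h : ∀ᵐ y, y ∈ Icc (-R) R → deriv α (x + y) + deriv β (x - y) = k) : IsAffineDiff R α β x := by
  have hα' : LipschitzWith M fun t => α (x + t) := by
    simpa [Function.comp_def] using
      hα.comp ((LipschitzWith.const x).add (LipschitzWith.id (α := ℝ)))
  have hβ' : LipschitzWith M fun t => β (x - t) := by
    simpa [Function.comp_def] using
      hβ.comp ((LipschitzWith.const x).sub (LipschitzWith.id (α := ℝ)))
  let ψ : ℝ → ℝ := fun t => α (x + t) - β (x - t) - k * t
  have hψ : ∃ L, LipschitzWith L ψ :=
    ⟨_, (hα'.sub hβ').sub (LipschitzWith.of_dist_le_mul (K := ‖k‖₊) fun a b => by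
      rw [Real.dist_eq, Real.dist_eq, ← mul_sub, abs_mul]; simp)⟩
  obtain ⟨L, hL⟩ := hψ
  obtain ⟨C, hC⟩ := (hL.lipschitzOnWith (s := uIcc (-R) R)).absolutelyContinuousOnInterval
    |>.const_of_ae_hasDerivAt_zero (by
      filter_upwards [h, hα'.ae_differentiableAt, hβ'.ae_differentiableAt] with t ht h1 h2 htR
      rw [uIcc_of_le (by linarith)] at htR
      have e1 := deriv_comp_const_add (f := α) x t
      have e2 := deriv_comp_const_sub (f := β) x t
      have := (h1.hasDerivAt.sub h2.hasDerivAt).sub ((hasDerivAt_id t).const_mul k)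
      rw [e1, e2] at this
      rwa [show deriv α (x + t) - -deriv β (x - t) - k * 1 = 0 by linarith [ht htR]] at this)
  rw [uIcc_of_le (by linarith)] at hC
  have h0 := hC 0 ⟨by linarith, hR.le⟩
  have h1 := hC R ⟨by linarith, le_rfl⟩
  intro t ht
  have h2 := hC t ht
  simp only [ψ, add_zero, sub_zero, mul_zero] at h0 h1 h2
  have : α (x + R) - β (x - R) - (α x - β x) = k * R := by linarith
  rw [this]
  field_simp
  linarith

lemma IsAffineDiff.swap {R : ℝ} (hR : 0 < R) {α β : ℝ → ℝ} {x : ℝ} (h : IsAffineDiff R α β x) :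
    IsAffineDiff R β α x := by
  intro t ht
  have h1 := h (-t) ⟨by linarith [ht.2], by linarith [ht.1]⟩
  have h2 := h (-R) ⟨le_rfl, by linarith⟩
  simp only [sub_neg_eq_add, ← sub_eq_add_neg] at h1 h2
  set q := (α (x + R) - β (x - R) - (α x - β x)) / R
  have : β (x + R) - α (x - R) - (β x - α x) = R * q := by linarith
  rw [this, mul_div_cancel_left₀ _ hR.ne']
  linarith

lemma continuousOn_deriv_of_isAffineDiff {R : ℝ} {α β : ℝ → ℝ} (hα : Continuous α)
    (hβ : Continuous β) {a b : ℝ} (hab : a < b) (hJ : Icc a b ⊆ Icc (-(R / 2)) (R / 2))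
    (h : ∀ x ∈ Icc a b, IsAffineDiff R α β x) :
    ContinuousOn (deriv α) (Ioo (-(R / 2)) (R / 2)) := by
  let m : ℝ → ℝ := fun x => (α (x + R) - β (x - R) - (α x - β x)) / R
  have hm : Continuous m := by fun_prop
  let C₁ : ℝ := ∫ x in a..b, (α x - β x - m x * x)
  let C₂ : ℝ := ∫ x in a..b, m x
  let G : ℝ → ℝ := fun s =>
    ((∫ y in (0 : ℝ)..(2 * b - s), β y) - (∫ y in (0 : ℝ)..(2 * a - s), β y)) / 2 + C₁ + C₂ * s
  have hrep : ∀ s ∈ Ioo (-(R / 2)) (R / 2), α s = G s / (b - a) := by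
    intro s hs
    have h1 : ∫ x in a..b, α s = ∫ x in a..b, (β (2 * x - s) + (α x - β x - m x * x) + m x * s) := by
      refine intervalIntegral.integral_congr fun x hx => ?_
      rw [uIcc_of_le hab.le] at hx
      have hxR := hJ hx
      have := h x hx (s - x) ⟨by linarith [hs.1, hxR.2], by linarith [hs.2, hxR.1]⟩
      have e1 : x + (s - x) = s := by ring
      have e2 : x - (s - x) = 2 * x - s := by ring
      rw [e1, e2] at this
      simp only [m]
      linarith
    rw [intervalIntegral.integral_const, intervalIntegral.integral_add
      (Continuous.intervalIntegrable (by fun_prop) _ _)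
      (Continuous.intervalIntegrable (by fun_prop) _ _), intervalIntegral.integral_add
      (Continuous.intervalIntegrable (by fun_prop) _ _)
      (Continuous.intervalIntegrable (by fun_prop) _ _), intervalIntegral.integral_mul_const,
      intervalIntegral.integral_comp_mul_sub (f := β) (c := 2) (by norm_num) s,
      ← intervalIntegral.integral_interval_sub_left (hβ.intervalIntegrable 0 _)
        (hβ.intervalIntegrable 0 _)] at h1
    rw [eq_div_iff (by linarith)]
    simp only [smul_eq_mul] at h1
    simp only [G, C₁, C₂]
    linarith
  have hG : ∀ s, HasDerivAt G ((β (2 * b - s) * (-1) - β (2 * a - s) * (-1)) / 2 + C₂) s := by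
    intro s
    have hI : ∀ c, HasDerivAt (fun s => ∫ y in (0 : ℝ)..(2 * c - s), β y)
        (β (2 * c - s) * (-1)) s := fun c =>
      (hβ.integral_hasStrictDerivAt 0 (2 * c - s)).hasDerivAt.comp s
        ((hasDerivAt_id s).const_sub (2 * c))
    have := ((((hI b).sub (hI a)).div_const 2).add_const C₁).add ((hasDerivAt_id s).const_mul C₂)
    rwa [mul_one] at this
  have hd : ∀ s ∈ Ioo (-(R / 2)) (R / 2), deriv α s =
      ((β (2 * b - s) * (-1) - β (2 * a - s) * (-1)) / 2 + C₂) / (b - a) := by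
    intro s hs
    have : α =ᶠ[𝓝 s] fun s => G s / (b - a) :=
      eventuallyEq_of_mem (isOpen_Ioo.mem_nhds hs) hrep
    rw [this.deriv_eq, ((hG s).div_const _).deriv]
  exact ContinuousOn.congr (by fun_prop) hd

lemma continuousOn_deriv_or_continuousOn_deriv {a b c : ℝ} (hab : a < b) (hbc : b < c)
    (hne : a + c ≠ 2 * b) {R : ℝ} (hR : 0 < R) {α β γ δ : ℝ → ℝ} {M : ℝ≥0}
    (hα : LipschitzWith M α) (hβ : LipschitzWith M β) (hγ : LipschitzWith M γ)
    (hδ : LipschitzWith M δ) {g : ℝ}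
    (h : ∀ᵐ x, x ∈ Icc (-R) R → ∀ᵐ y, y ∈ Icc (-R) R → ∀ᵐ z, z ∈ Icc (-R) R →
      g + (deriv α (x + y) + deriv β (x - y)) + (deriv γ (x + z) + deriv δ (x - z)) ∈
        ({a, b, c} : Set ℝ)) :
    (ContinuousOn (deriv α) (Ioo (-(R / 2)) (R / 2)) ∧
      ContinuousOn (deriv β) (Ioo (-(R / 2)) (R / 2))) ∨
    (ContinuousOn (deriv γ) (Ioo (-(R / 2)) (R / 2)) ∧
      ContinuousOn (deriv δ) (Ioo (-(R / 2)) (R / 2))) := by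
  let A := {x | IsAffineDiff R α β x}
  let B := {x | IsAffineDiff R γ δ x}
  have hA : IsClosed A := isClosed_setOf_isAffineDiff hα.continuous hβ.continuous
  have hB : IsClosed B := isClosed_setOf_isAffineDiff hγ.continuous hδ.continuous
  have hae : ∀ᵐ x, x ∈ Icc (-R) R → x ∈ A ∪ B := by
    filter_upwards [h] with x hx hxR
    have key := ae_eq_const_or_ae_eq_const_of_add_mem hab hbc hne
      (μ := volume.restrict (Icc (-R) R))
      (f := fun y => g + (deriv α (x + y) + deriv β (x - y)))
      (h := fun z => deriv γ (x + z) + deriv δ (x - z)) (by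
        rw [ae_restrict_iff' measurableSet_Icc]
        filter_upwards [hx hxR] with y hy hyR
        rw [ae_restrict_iff' measurableSet_Icc]
        exact hy hyR)
    simp only [ae_restrict_iff' measurableSet_Icc] at key
    rcases key with ⟨k, hk⟩ | ⟨k, hk⟩
    · refine Or.inl (isAffineDiff_of_ae_deriv_eq hR hα hβ (k := k - g) ?_)
      filter_upwards [hk] with y hy hyR
      linarith [hy hyR]
    · exact Or.inr (isAffineDiff_of_ae_deriv_eq hR hγ hδ hk)
  have hall : Ioo (-R) R ⊆ A ∪ B := by
    have hO : IsOpen (Ioo (-R) R \ (A ∪ B)) := isOpen_Ioo.sdiff (hA.union hB)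
    have h0 : volume (Ioo (-R) R \ (A ∪ B)) = 0 := by
      refine measure_mono_null (fun x hx => ?_) hae
      exact fun hcon => hx.2 (hcon (Ioo_subset_Icc_self hx.1))
    rw [hO.measure_eq_zero_iff volume] at h0
    exact sdiff_eq_empty.1 h0
  have hsub : Icc (-(R / 2)) (R / 2) ⊆ Ioo (-R) R := Icc_subset_Ioo (by linarith) (by linarith)
  by_cases hcase : Ioo (-(R / 2)) (R / 2) ⊆ A
  · have hJ : Icc (-(R / 4)) (R / 4) ⊆ Ioo (-(R / 2)) (R / 2) :=
      Icc_subset_Ioo (by linarith) (by linarith)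
    have hlt : -(R / 4) < R / 4 := by linarith
    exact Or.inl ⟨continuousOn_deriv_of_isAffineDiff hα.continuous hβ.continuous hlt
      (hJ.trans Ioo_subset_Icc_self) fun x hx => hcase (hJ hx),
      continuousOn_deriv_of_isAffineDiff hβ.continuous hα.continuous hlt
      (hJ.trans Ioo_subset_Icc_self) fun x hx => (hcase (hJ hx)).swap hR⟩
  · obtain ⟨x, hx, hxA⟩ := not_subset.1 hcase
    obtain ⟨a', b', hmem, hJ⟩ := mem_nhds_iff_exists_Ioo_subset.1
      ((isOpen_Ioo.inter hA.isOpen_compl).mem_nhds ⟨hx, hxA⟩)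
    obtain ⟨l, hal, hlx⟩ := exists_between hmem.1
    have hJ' : Icc l x ⊆ Ioo (-(R / 2)) (R / 2) ∩ Aᶜ := fun y hy =>
      hJ ⟨hal.trans_le hy.1, hy.2.trans_lt hmem.2⟩
    have hJR : Icc l x ⊆ Icc (-(R / 2)) (R / 2) := fun y hy => Ioo_subset_Icc_self (hJ' hy).1
    have hJB : ∀ y ∈ Icc l x, IsAffineDiff R γ δ y := fun y hy =>
      (hall (hsub (hJR hy))).resolve_left (hJ' hy).2
    exact Or.inr ⟨continuousOn_deriv_of_isAffineDiff hγ.continuous hδ.continuous hlx hJR hJB,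
      continuousOn_deriv_of_isAffineDiff hδ.continuous hγ.continuous hlx hJR
        fun y hy => (hJB y hy).swap hR⟩

lemma exists_eq_well3 {η₁ η₂ η₃ : ℝ} {A : Matrix (Fin 3) (Fin 3) ℝ} (hA : A ∈ K3 η₁ η₂ η₃) :
    ∃ l, A = well3 η₁ η₂ η₃ l := by
  rcases hA with h | h | h
  exacts [⟨0, h⟩, ⟨1, h⟩, ⟨2, h⟩]

lemma well3_apply_of_ne (η₁ η₂ η₃ : ℝ) (l : Fin 3) {i j : Fin 3} (h : i ≠ j) :
    well3 η₁ η₂ η₃ l i j = 0 := by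
  fin_cases l <;> simp [well3, h]

lemma sum_well3_apply (η₁ η₂ η₃ : ℝ) (l : Fin 3) :
    ∑ i, well3 η₁ η₂ η₃ l i i = η₁ + η₂ + η₃ := by
  fin_cases l <;> simp [well3, Fin.sum_univ_three] <;> ring

lemma well3_apply_self_mem (η₁ η₂ η₃ : ℝ) (l i : Fin 3) :
    well3 η₁ η₂ η₃ l i i ∈ ({η₂, η₁, η₃} : Set ℝ) := by
  fin_cases l <;> fin_cases i <;> simp [well3]

lemma eq_of_well3_apply_eq {η₁ η₂ η₃ : ℝ} (h1 : η₂ < η₁) (h2 : η₁ < η₃) {l m : Fin 3} (i : Fin 3)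
    (h : well3 η₁ η₂ η₃ l i i = well3 η₁ η₂ η₃ m i i) : l = m := by
  have h3 := h1.trans h2
  fin_cases l <;> fin_cases m <;> fin_cases i <;>
    simp [well3, h1.ne, h1.ne', h2.ne, h2.ne', h3.ne, h3.ne'] at h ⊢

lemma ae_ae_ae_of_ae {q : V3 → Prop} (h : ∀ᵐ x, q x) {i j k : Fin 3} (hij : i ≠ j) (hjk : j ≠ k)
    (hik : i ≠ k) (p : V3) :
    ∀ᵐ a : ℝ, ∀ᵐ b : ℝ, ∀ᵐ c : ℝ, q (p + (a • stdVec i + b • stdVec j + c • stdVec k)) := by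
  let L : ℝ × ℝ × ℝ →ₗ[ℝ] V3 :=
    (LinearMap.toSpanSingleton ℝ V3 (stdVec i)).coprod
      ((LinearMap.toSpanSingleton ℝ V3 (stdVec j)).coprod
        (LinearMap.toSpanSingleton ℝ V3 (stdVec k)))
  have hL : ∀ a b c, L (a, b, c) = a • stdVec i + b • stdVec j + c • stdVec k := fun a b c => by
    simp [L, add_assoc]
  have hsurj : Function.Surjective L := by
    intro x
    refine ⟨(x i, x j, x k), ?_⟩
    rw [hL]
    ext l
    rcases Fin.eq_or_eq_or_eq_of_ne hij hjk hik l with rfl | rfl | rfl <;>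
      simp [stdVec_apply, hij, hik, hjk, hij.symm, hik.symm, hjk.symm]
  have hp : ∀ᵐ x, q (p + x) := (measurePreserving_add_left volume p).quasiMeasurePreserving.ae h
  have : ((volume : Measure ℝ).prod
      ((volume : Measure ℝ).prod (volume : Measure ℝ))).IsAddHaarMeasure :=
    Measure.prod.instIsAddHaarMeasure _ _
  have hm := (MeasureTheory.ae_comp_linearMap_mem_iff L
    ((volume : Measure ℝ).prod ((volume : Measure ℝ).prod (volume : Measure ℝ))) volume hsurj
    (measurableSet_toMeasurable volume {x | ¬ q (p + x)}).compl).2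
    (measure_eq_zero_iff_ae_notMem.1 ((measure_toMeasurable _).trans hp))
  filter_upwards [Measure.ae_ae_of_ae_prod hm] with a ha
  filter_upwards [Measure.ae_ae_of_ae_prod ha] with b hb
  filter_upwards [hb] with c hc
  rw [hL] at hc
  by_contra hcon
  exact hc (subset_toMeasurable _ _ hcon)

lemma exists_ball_ae_eq_well3 {η₁ η₂ η₃ : ℝ} (h1 : η₂ < η₁) (h2 : η₁ < η₃) (h3 : 2 * η₁ < η₂ + η₃)
    {u : V3 → V3} {K : ℝ≥0} (hu : LipschitzWith K u) {p : V3} {r : ℝ} (hr : 0 < r)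
    (hincl : ∀ᵐ x, x ∈ Metric.ball p (2 * r) → symGrad3 u x ∈ K3 η₁ η₂ η₃) :
    ∃ l, ∃ ρ > 0, ∀ᵐ x, x ∈ Metric.ball p ρ → symGrad3 u x = well3 η₁ η₂ η₃ l := by
  have hsym : ∀ x i, symGrad3 u x i i = fderiv ℝ u x (stdVec i) i := fun x i => by
    simp [symGrad3, stdVec]
  obtain ⟨g, α, β, hw⟩ := exists_isWaveSum hu hr (c := η₁ + η₂ + η₃)
    (fun i j hij => by
      filter_upwards [hincl] with x hx hxb
      obtain ⟨l, hl⟩ := exists_eq_well3 (hx hxb)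
      have : symGrad3 u x i j = 0 := by rw [hl, well3_apply_of_ne _ _ _ _ hij]
      simp only [symGrad3] at this
      simp only [stdVec]
      linarith)
    (by
      filter_upwards [hincl] with x hx hxb
      obtain ⟨l, hl⟩ := exists_eq_well3 (hx hxb)
      simp only [← hsym, hl, sum_well3_apply])
  have hball : Metric.ball p r ⊆ Metric.ball p (2 * r) := Metric.ball_subset_ball (by linarith)
  let S : Set ℝ := {η₂, η₁, η₃}
  let F : Fin 3 → Fin 3 → Fin 3 → V3 → ℝ := fun i j k x => g i +
      (deriv (α i j) (x i - p i + (x j - p j)) + deriv (β i j) (x i - p i - (x j - p j))) +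
      (deriv (α i k) (x i - p i + (x k - p k)) + deriv (β i k) (x i - p i - (x k - p k)))
  have hF : ∀ i j k, i ≠ j → j ≠ k → i ≠ k → ∀ᵐ x, x ∈ Metric.ball p r →
      symGrad3 u x i i = F i j k x ∧ F i j k x ∈ S := by
    intro i j k hij hjk hik
    filter_upwards [hw.ae_fderiv_apply_eq hu hij hjk hik, hincl] with x hx hx' hxb
    have e : symGrad3 u x i i = F i j k x := (hsym x i).trans (hx hxb)
    refine ⟨e, e ▸ ?_⟩
    obtain ⟨l, hl⟩ := exists_eq_well3 (hx' (hball hxb))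
    rw [hl]
    exact well3_apply_self_mem _ _ _ _ _
  set I : Set ℝ := Ioo (-(r / 2 / 2)) (r / 2 / 2) with hI
  let Q : Fin 3 → Fin 3 → Prop := fun i j =>
    ContinuousOn (deriv (α i j)) I ∧ ContinuousOn (deriv (β i j)) I
  have hQ : ∀ i j k, i ≠ j → j ≠ k → i ≠ k → Q i j ∨ Q i k := by
    intro i j k hij hjk hik
    refine continuousOn_deriv_or_continuousOn_deriv h1 h2 (by linarith) (half_pos hr)
      (hw.lipschitz_left i j) (hw.lipschitz_right i j) (hw.lipschitz_left i k)
      (hw.lipschitz_right i k) (g := g i) ?_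
    filter_upwards [ae_ae_ae_of_ae (hF i j k hij hjk hik) hij hjk hik p] with a ha haR
    filter_upwards [ha] with b hb hbR
    filter_upwards [hb] with c hc hcR
    have := (hc (by
      rw [mem_ball_iff_of_ne hij hjk hik hr]
      simp [stdVec_apply, hij, hik, hjk, hij.symm, hik.symm, hjk.symm]
      have hsq : ∀ t ∈ Icc (-(r / 2)) (r / 2), t ^ 2 ≤ r ^ 2 / 4 := fun t ht => by
        nlinarith [ht.1, ht.2]
      nlinarith [hsq a haR, hsq b hbR, hsq c hcR])).2
    simpa [F, S, stdVec_apply, hij, hik, hjk, hij.symm, hik.symm, hjk.symm] using this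
  have hQswap : ∀ i j, Q i j → Q j i := by
    rintro i j ⟨hα, hβ⟩
    have e1 : α j i = fun s => - α i j s := funext (hw.left_swap i j)
    have e2 : β j i = fun s => β i j (-s) := funext (hw.right_swap i j)
    refine ⟨?_, ?_⟩
    · rw [e1, deriv.fun_neg']
      exact hα.neg
    · have : deriv (fun s => β i j (-s)) = fun s => - deriv (β i j) (-s) :=
        funext fun s => deriv_comp_neg (β i j) s
      rw [e2, this]
      refine (hβ.comp continuousOn_neg fun s hs => ?_).neg
      exact ⟨by linarith [hs.2], by linarith [hs.1]⟩
  obtain ⟨i, j, k, hij, hjk, hik, hQj, hQk⟩ :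
      ∃ i j k, i ≠ j ∧ j ≠ k ∧ i ≠ k ∧ Q i j ∧ Q i k := by
    have q0 := hQ 0 1 2 (by decide) (by decide) (by decide)
    have q1 := hQ 1 0 2 (by decide) (by decide) (by decide)
    have q2 := hQ 2 0 1 (by decide) (by decide) (by decide)
    by_cases q01 : Q 0 1
    · by_cases q02 : Q 0 2
      · exact ⟨0, 1, 2, by decide, by decide, by decide, q01, q02⟩
      · have := q2.resolve_left fun h => q02 (hQswap _ _ h)
        exact ⟨1, 0, 2, by decide, by decide, by decide, hQswap _ _ q01, hQswap _ _ this⟩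
    · have := q1.resolve_left fun h => q01 (hQswap _ _ h)
      exact ⟨2, 0, 1, by decide, by decide, by decide, hQswap _ _ (q0.resolve_left q01),
        hQswap _ _ this⟩
  set ρ := r / 8 with hρ
  have hρ0 : 0 < ρ := by positivity
  have hρr : Metric.ball p ρ ⊆ Metric.ball p r := Metric.ball_subset_ball (by linarith)
  have hcoord : ∀ x ∈ Metric.ball p ρ, ∀ l, |x l - p l| < ρ := by
    intro x hx l
    rw [mem_ball_iff_norm] at hx
    exact lt_of_le_of_lt (by simpa using PiLp.norm_apply_le (x - p) l) hx
  have hcont : ∀ {l}, Q i l → ContinuousOn (fun x : V3 => deriv (α i l) (x i - p i + (x l - p l)) +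
      deriv (β i l) (x i - p i - (x l - p l))) (Metric.ball p ρ) := by
    intro l hl
    refine (hl.1.comp (by fun_prop) fun x hx => ?_).add (hl.2.comp (by fun_prop) fun x hx => ?_) <;>
    · have e1 := abs_lt.1 (hcoord x hx i)
      have e2 := abs_lt.1 (hcoord x hx l)
      exact ⟨by linarith [e1.1, e1.2, e2.1, e2.2], by linarith [e1.1, e1.2, e2.1, e2.2]⟩
  have hFc : ContinuousOn (F i j k) (Metric.ball p ρ) :=
    ((continuousOn_const.add (hcont hQj)).add (hcont hQk))
  have hS : S.Finite := Set.toFinite _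
  have hmaps : MapsTo (F i j k) (Metric.ball p ρ) S := by
    have hO : IsOpen (Metric.ball p ρ ∩ F i j k ⁻¹' Sᶜ) :=
      hFc.isOpen_inter_preimage Metric.isOpen_ball hS.isClosed.isOpen_compl
    have h0 : volume (Metric.ball p ρ ∩ F i j k ⁻¹' Sᶜ) = 0 := by
      refine measure_mono_null (fun x hx => ?_) (hF i j k hij hjk hik)
      exact fun hcon => hx.2 (hcon (hρr hx.1)).2
    rw [hO.measure_eq_zero_iff volume] at h0
    intro x hx
    by_contra hcon
    exact (h0 ▸ (⟨hx, hcon⟩ : x ∈ Metric.ball p ρ ∩ F i j k ⁻¹' Sᶜ) : x ∈ (∅ : Set V3))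
  have hpB : p ∈ Metric.ball p ρ := Metric.mem_ball_self hρ0
  have hconst : ∀ x ∈ Metric.ball p ρ, F i j k x = F i j k p := fun x hx =>
    (convex_ball p ρ).isPreconnected.constant_of_mapsTo hS.isDiscrete hFc hmaps hx hpB
  have hae : ∀ᵐ x, x ∈ Metric.ball p ρ → ∃ l, symGrad3 u x = well3 η₁ η₂ η₃ l ∧
      well3 η₁ η₂ η₃ l i i = F i j k p := by
    filter_upwards [hF i j k hij hjk hik, hincl] with x hx hx' hxb
    obtain ⟨l, hl⟩ := exists_eq_well3 (hx' (hball (hρr hxb)))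
    refine ⟨l, hl, ?_⟩
    rw [← hconst x hxb, ← (hx (hρr hxb)).1, hl]
  obtain ⟨x, hxb, hx⟩ : ∃ x ∈ Metric.ball p ρ, ∃ l, symGrad3 u x = well3 η₁ η₂ η₃ l ∧
      well3 η₁ η₂ η₃ l i i = F i j k p := by
    by_contra! hcon
    refine (Metric.measure_ball_pos volume p hρ0).ne' (measure_mono_null (fun x hx => ?_) hae)
    intro hc
    obtain ⟨l, hl, hl'⟩ := hc hx
    exact hcon x hx l hl hl'
  obtain ⟨l, -, hl⟩ := hx
  refine ⟨l, ρ, hρ0, ?_⟩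
  filter_upwards [hae] with x hx hxb
  obtain ⟨m, hm, hm'⟩ := hx hxb
  rw [hm, eq_of_well3_apply_eq h1 h2 i (hm'.trans hl.symm)]

/-- decomposition of the diagonal strain components into functions of single
variables. -/
theorem stmt8 (η₁ η₂ η₃ : ℝ) (h1 : η₂ < η₁) (h2 : η₁ < η₃) (h3 : 2 * η₁ < η₂ + η₃)
    (Ω : Set V3) (hΩo : IsOpen Ω) (hΩsc : SimplyConnectedSpace Ω)
    (u : V3 → V3) (K : NNReal) (hu : LipschitzWith K u)
    (hincl : ∀ᵐ x ∂volume.restrict Ω, symGrad3 u x ∈ K3 η₁ η₂ η₃) :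
    ∃ f : Fin 3 → Fin 3 → (ℝ → ℝ),
      ∀ᵐ x ∂volume.restrict Ω, ∀ i : Fin 3,
        symGrad3 u x i i = f i 0 (x 0) + f i 1 (x 1) + f i 2 (x 2) := by
  rw [ae_restrict_iff' hΩo.measurableSet] at hincl
  have hloc : ∀ p : Ω, ∃ l, ∃ ρ > 0, ∀ᵐ x, x ∈ Metric.ball (p : V3) ρ →
      symGrad3 u x = well3 η₁ η₂ η₃ l := by
    intro p
    obtain ⟨r, hr, hrΩ⟩ := Metric.isOpen_iff.1 hΩo p p.2
    refine exists_ball_ae_eq_well3 h1 h2 h3 hu (half_pos hr) ?_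
    filter_upwards [hincl] with x hx hxb
    exact hx (hrΩ (by rwa [mul_div_cancel₀ _ two_ne_zero] at hxb))
  choose ℓ ρ hρ hℓ using hloc
  have hlc : IsLocallyConstant ℓ := by
    rw [IsLocallyConstant.iff_eventually_eq]
    intro p
    filter_upwards [Metric.ball_mem_nhds p (hρ p)] with q hq
    have hO : IsOpen (Metric.ball (p : V3) (ρ p) ∩ Metric.ball (q : V3) (ρ q)) :=
      Metric.isOpen_ball.inter Metric.isOpen_ball
    have hpos := hO.measure_pos volume ⟨q, hq, Metric.mem_ball_self (hρ q)⟩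
    by_contra hne
    refine hpos.ne' (measure_mono_null (fun x hx => ?_) ((hℓ p).and (hℓ q)))
    exact fun hcon => hne (eq_of_well3_apply_eq h1 h2 0
      (by rw [← hcon.1 hx.1, ← hcon.2 hx.2]))
  obtain ⟨p₀⟩ : Nonempty Ω := inferInstance
  refine ⟨fun i m _ => if m = 0 then well3 η₁ η₂ η₃ (ℓ p₀) i i else 0, ?_⟩
  rw [ae_restrict_iff' hΩo.measurableSet]
  have hall : volume {x | x ∈ Ω ∧ symGrad3 u x ≠ well3 η₁ η₂ η₃ (ℓ p₀)} = 0 := by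
    refine measure_null_of_locally_null _ fun x hx => ?_
    refine ⟨_, inter_mem_nhdsWithin _ (Metric.ball_mem_nhds x (hρ ⟨x, hx.1⟩)), ?_⟩
    refine measure_mono_null (fun y hy => ?_) (hℓ ⟨x, hx.1⟩)
    intro hcon
    refine hy.1.2 ((hcon hy.2).trans ?_)
    rw [hlc.apply_eq_of_preconnectedSpace]
  filter_upwards [measure_eq_zero_iff_ae_notMem.1 hall] with x hx hxΩ i
  have : symGrad3 u x = well3 η₁ η₂ η₃ (ℓ p₀) := by
    by_contra hne
    exact hx ⟨hxΩ, hne⟩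
  simp [this]
end
end
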